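/- For every ε > 0 there is a constant c depending only on n, R, d, ε (not on C̃) such that for every q ∈ ℤ_{>0} and every a ∈ ℤ^R with gcd(a_1, …, a_R, q) = 1 one has |S_{a,q}| ≤ c C̃^{K/(d−1)} q^{n − K/(R(d−1)) + ε}. -/

import Mathlib

open MeasureTheory Filter MvPolynomial

noncomputable section

/-- `e t = exp (2 π i t)` -/
def eC (t : ℝ) : ℂ := Complex.exp (2 * (Real.pi : ℂ) * Complex.I * (t : ℂ))

abbrev Qbar : Type := AlgebraicClosure ℚ

/-- Dimension of the affine singular locus of `g` (the common zero set of the partial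
derivatives of `g`), as the Krull dimension of its coordinate ring. -/
def singDim (n : ℕ) (g : MvPolynomial (Fin n) Qbar) : WithBot ℕ∞ :=
  ringKrullDim (MvPolynomial (Fin n) Qbar ⧸
    Ideal.span (Set.range fun j : Fin n => MvPolynomial.pderiv j g))

/-- `Δ = max_{b ∈ ℤ^R \ {0}} dim Sing(b₁ g₁ + ⋯ + b_R g_R)`. -/
def birchDelta (n R : ℕ) (g : Fin R → MvPolynomial (Fin n) ℤ) : WithBot ℕ∞ :=
  ⨆ (b : Fin R → ℤ) (_ : b ≠ 0),
    singDim n (MvPolynomial.map (Int.castRingHom Qbar) (∑ i, b i • g i))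

/-- `K = (n - Δ)/2^(d-1)` where `Δ = max_{b ≠ 0} dim Sing(f̃_b)`. -/
def KofDelta (n R d : ℕ) (g : Fin R → MvPolynomial (Fin n) ℤ) (K : ℝ) : Prop :=
  ∃ Δ : ℕ, ((Δ : ℕ∞) : WithBot ℕ∞) = birchDelta n R g ∧
    K = ((n : ℝ) - (Δ : ℝ)) / 2 ^ (d - 1)

/-- The quantity `R(R+1)(d-1)` as a real number. -/
def BB (R d : ℕ) : ℝ := (R : ℝ) * ((R : ℝ) + 1) * ((d : ℝ) - 1)

/-- The `R × R` minor of the Jacobian matrix of `f` with columns given by the elements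
of `I`. -/
def jacMinor {n R : ℕ} (f : Fin R → MvPolynomial (Fin n) ℤ)
    (I : Finset (Fin n)) (hI : I.card = R) : MvPolynomial (Fin n) ℤ :=
  Matrix.det (Matrix.of fun i k : Fin R => MvPolynomial.pderiv (I.orderEmbOfFin hI k) (f i))

/-- `Cv` is the maximum of the absolute values of the coefficients of the `f i`. -/
def coeffMax {n R : ℕ} (f : Fin R → MvPolynomial (Fin n) ℤ) (Cv : ℝ) : Prop :=
  IsGreatest {x : ℝ | ∃ (i : Fin R) (m : (Fin n) →₀ ℕ), x = |((MvPolynomial.coeff m (f i) : ℤ) : ℝ)|} Cv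

/-- The integer points of the dilated box `P𝓑`. -/
def boxPts {n : ℕ} (aB bB : Fin n → ℝ) (P : ℝ) : Finset (Fin n → ℤ) :=
  Finset.Icc (fun j => ⌈P * aB j⌉) (fun j => ⌊P * bB j⌋)

/-- The exponential sum `S(α) = ∑_{x ∈ P𝓑 ∩ ℤ^n} e(α · f(x))`. -/
def Sexp {n R : ℕ} (f : Fin R → MvPolynomial (Fin n) ℤ) (aB bB : Fin n → ℝ) (P : ℝ)
    (α : Fin R → ℝ) : ℂ :=
  ∑ x ∈ boxPts aB bB P, eC (∑ i, α i * (MvPolynomial.eval x (f i) : ℝ))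

/-- The complete exponential sum `S_{a,q} = ∑_{x mod q} e(a · f(x)/q)`. -/
def Sgauss {n R : ℕ} (f : Fin R → MvPolynomial (Fin n) ℤ) (q : ℕ) (a : Fin R → ℤ) : ℂ :=
  ∑ x : Fin n → Fin q,
    eC ((∑ i, (a i : ℝ) * (MvPolynomial.eval (fun j => ((x j : ℕ) : ℤ)) (f i) : ℝ)) / q)

/-- `S_{a,q}(ν) = S_{a,q} e(-a·ν/q)`. -/
def SgaussNu {n R : ℕ} (f : Fin R → MvPolynomial (Fin n) ℤ) (q : ℕ) (a : Fin R → ℤ)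
    (ν : Fin R → ℤ) : ℂ :=
  Sgauss f q a * eC (-(∑ i, (a i : ℝ) * (ν i : ℝ)) / q)

/-- Residues `1 ≤ aᵢ ≤ q` (coded by `Fin q`, shifted by one) with `gcd(a₁, …, a_R, s) = 1`. -/
def resSet (R q s : ℕ) : Finset (Fin R → Fin q) :=
  Finset.univ.filter fun a => Nat.gcd (Finset.univ.gcd fun i => (a i : ℕ) + 1) s = 1

/-- The singular series `𝔖(ν)`. -/
def singularSeries {n R : ℕ} (f : Fin R → MvPolynomial (Fin n) ℤ) (ν : Fin R → ℤ) : ℂ :=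
  ∑' q : ℕ, ((q : ℂ) ^ n)⁻¹ *
    ∑ a ∈ resSet R q q, SgaussNu f q (fun i => ((a i : ℕ) : ℤ) + 1) ν

/-- The local density `𝔖_p(ν)`. -/
def localDensity {n R : ℕ} (f : Fin R → MvPolynomial (Fin n) ℤ) (ν : Fin R → ℤ) (p : ℕ) : ℂ :=
  ∑' r : ℕ, ((p : ℂ) ^ (r * n))⁻¹ *
    ∑ a ∈ resSet R (p ^ r) p, SgaussNu f (p ^ r) (fun i => ((a i : ℕ) : ℤ) + 1) ν

/-- The box `𝓑 = ∏ⱼ [aⱼ, bⱼ]` as a subset of `ℝ^n`. -/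
def boxSet {n : ℕ} (aB bB : Fin n → ℝ) : Set (Fin n → ℝ) :=
  Set.univ.pi fun j => Set.Icc (aB j) (bB j)

/-- The oscillatory integral `I(𝓒, γ) = ∫_{ζ ∈ 𝓒} e(γ · g(ζ)) dζ`. -/
def Iosc {n R : ℕ} (g : Fin R → MvPolynomial (Fin n) ℤ) (C : Set (Fin n → ℝ))
    (γ : Fin R → ℝ) : ℂ :=
  ∫ ζ in C, eC (∑ i, γ i * MvPolynomial.aeval ζ (g i))

/-- `J(μ, Φ) = ∫_{|γ| ≤ Φ} I(𝓑, γ) e(-γ·μ) dγ`. -/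
def Jint {n R : ℕ} (g : Fin R → MvPolynomial (Fin n) ℤ) (aB bB : Fin n → ℝ)
    (μ : Fin R → ℝ) (Φ : ℝ) : ℂ :=
  ∫ γ in {γ : Fin R → ℝ | ∀ i, |γ i| ≤ Φ}, Iosc g (boxSet aB bB) γ * eC (-(∑ i, γ i * μ i))

/-- The singular integral `J(μ) = lim_{Φ → ∞} J(μ, Φ)`. -/
def Jlim {n R : ℕ} (g : Fin R → MvPolynomial (Fin n) ℤ) (aB bB : Fin n → ℝ)
    (μ : Fin R → ℝ) : ℂ :=
  limUnder Filter.atTop fun Φ : ℝ => Jint g aB bB μ Φ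

/-- `M(P, ν)`: the number of integer points `x ∈ P𝓑` with `f(x) = ν`. -/
def Mcount {n R : ℕ} (f : Fin R → MvPolynomial (Fin n) ℤ) (aB bB : Fin n → ℝ) (P : ℝ)
    (ν : Fin R → ℤ) : ℕ :=
  ((boxPts aB bB P).filter fun x => ∀ i, MvPolynomial.eval x (f i) = ν i).card

/-- A single major arc `𝔐_{a,q}(θ)`. -/
def majorArc {R : ℕ} (d : ℕ) (Ct P θ : ℝ) (q : ℕ) (a : Fin R → ℤ) : Set (Fin R → ℝ) :=
  Set.univ.pi fun i => Set.Icc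
    ((a i : ℝ) / q - Ct ^ (R - 1) * P ^ (-(d : ℝ) + (R : ℝ) * ((d : ℝ) - 1) * θ) / (2 * q))
    ((a i : ℝ) / q + Ct ^ (R - 1) * P ^ (-(d : ℝ) + (R : ℝ) * ((d : ℝ) - 1) * θ) / (2 * q))

/-- The major arcs `𝔐(θ)`. -/
def majorArcs (R d : ℕ) (Ct P θ : ℝ) : Set (Fin R → ℝ) :=
  ⋃ (q : ℕ) (_ : 1 ≤ q ∧ (q : ℝ) ≤ Ct ^ R * P ^ ((R : ℝ) * ((d : ℝ) - 1) * θ))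
    (a : Fin R → ℤ)
    (_ : (∀ i, 1 ≤ a i ∧ a i ≤ (q : ℤ)) ∧ Int.gcd (Finset.univ.gcd a) (q : ℤ) = 1),
    majorArc d Ct P θ q a

/-- The minor arcs `𝔪 = [0,1]^R \ 𝔐(θ)`, taken modulo `1`. -/
def minorArcs (R d : ℕ) (Ct P θ : ℝ) : Set (Fin R → ℝ) :=
  {α | (∀ i, 0 ≤ α i ∧ α i ≤ 1) ∧
    ∀ z : Fin R → ℤ, (fun i => α i + (z i : ℝ)) ∉ majorArcs R d Ct P θ}

/-- Nonsingularity of the affine variety `f = 0` over `ℚ̄`: at every common zero the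
Jacobian matrix has (maximal) rank `R`, i.e. some `R × R` minor is nonvanishing. -/
def AffineNonsingular {n : ℕ} (R : ℕ) (f : Fin R → MvPolynomial (Fin n) ℤ) : Prop :=
  ∀ x : Fin n → Qbar, (∀ i, MvPolynomial.aeval x (f i) = 0) →
    ∃ (I : Finset (Fin n)) (hI : I.card = R), MvPolynomial.aeval x (jacMinor f I hI) ≠ 0

/-- Nonsingularity of the projective variety `g = 0` over `ℚ̄` (for forms `g`): at every
nonzero point of the affine cone the Jacobian matrix has rank `R`. -/
def ProjNonsingular {n : ℕ} (R : ℕ) (g : Fin R → MvPolynomial (Fin n) ℤ) : Prop :=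
  ∀ x : Fin n → Qbar, x ≠ 0 → (∀ i, MvPolynomial.aeval x (g i) = 0) →
    ∃ (I : Finset (Fin n)) (hI : I.card = R), MvPolynomial.aeval x (jacMinor g I hI) ≠ 0


/-- Forward difference. -/
def gsDlt {G A : Type*} [Add G] [Sub A] (F : G → A) (h : G) : G → A := fun x => F (x + h) - F x

/-- Iterated forward difference. -/
def gsIterDlt {G A : Type*} [Add G] [Sub A] : (k : ℕ) → (Fin k → G) → (G → A) → (G → A)
  | 0, _, F => F
  | k + 1, h, F => gsIterDlt k (Fin.tail h) (gsDlt F (h 0))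

lemma gs_sum_cons {α M : Type*} [Fintype α] [AddCommMonoid M] (k : ℕ) (φ : (Fin (k+1) → α) → M) :
    ∑ h : Fin (k+1) → α, φ h = ∑ a : α, ∑ h : Fin k → α, φ (Fin.cons a h) := by
  rw [← Fintype.sum_prod_type' (f := fun (a : α) (h : Fin k → α) => φ (Fin.cons a h))]
  exact (Fintype.sum_equiv (Fin.consEquiv (fun _ : Fin (k+1) => α)) _ _ (fun x => rfl)).symm

lemma gs_weyl_sq {G A : Type*} [AddCommGroup G] [Fintype G] [AddCommGroup A] [Finite A]
    (χ : AddChar A ℂ) (F : G → A) :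
    ‖∑ x, χ (F x)‖ ^ 2 ≤ ∑ h, ‖∑ x, χ (gsDlt F h x)‖ := by
  have h1 : (∑ x, χ (F x)) * (starRingEnd ℂ) (∑ x, χ (F x)) = ∑ h, ∑ x, χ (gsDlt F h x) := by
    rw [map_sum, Finset.sum_mul_sum]
    rw [Finset.sum_comm (f := fun h x => χ (gsDlt F h x))]
    rw [Finset.sum_comm]
    refine Finset.sum_congr rfl fun x _ => ?_
    rw [← Equiv.sum_comp (Equiv.addLeft x) (fun y => χ (F y) * (starRingEnd ℂ) (χ (F x)))]
    refine Finset.sum_congr rfl fun y _ => ?_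
    rw [← AddChar.map_neg_eq_conj, ← AddChar.map_add_eq_mul]
    simp [gsDlt, sub_eq_add_neg]
  calc ‖∑ x, χ (F x)‖ ^ 2 = ‖(∑ x, χ (F x)) * (starRingEnd ℂ) (∑ x, χ (F x))‖ := by
        rw [norm_mul, RCLike.norm_conj, sq]
    _ ≤ _ := by rw [h1]; exact norm_sum_le _ _

lemma gs_weyl {G A : Type*} [AddCommGroup G] [Fintype G] [AddCommGroup A] [Finite A]
    (χ : AddChar A ℂ) (k : ℕ) : ∀ (F : G → A),
    ‖∑ x, χ (F x)‖ ^ (2 ^ k) * (Fintype.card G : ℝ) ^ (k + 1) ≤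
      (Fintype.card G : ℝ) ^ (2 ^ k) * ∑ h : Fin k → G, ‖∑ x, χ (gsIterDlt k h F x)‖ := by
  induction k with
  | zero => intro F; simp [gsIterDlt]; rw [mul_comm]
  | succ k ih =>
    intro F
    have h2 := gs_weyl_sq χ F
    obtain ⟨m, hm⟩ : ∃ m, 2 ^ k = m + 1 := ⟨2 ^ k - 1, by have := Nat.two_pow_pos k; omega⟩
    have hc : (0:ℝ) < Fintype.card G := by
      have : 0 < Fintype.card G := Fintype.card_pos
      exact_mod_cast this
    have h3 : (∑ h, ‖∑ x, χ (gsDlt F h x)‖) ^ (2 ^ k) ≤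
        (Fintype.card G : ℝ) ^ m * ∑ h, ‖∑ x, χ (gsDlt F h x)‖ ^ (2 ^ k) := by
      have := pow_sum_div_card_le_sum_pow (s := (Finset.univ : Finset G))
        (f := fun h => ‖∑ x, χ (gsDlt F h x)‖) (fun i _ => norm_nonneg _) m
      rw [div_le_iff₀ (by rw [Finset.card_univ]; positivity), ← hm, Finset.card_univ] at this
      rw [mul_comm]; exact this
    rw [gs_sum_cons]
    calc ‖∑ x, χ (F x)‖ ^ (2 ^ (k+1)) * (Fintype.card G : ℝ) ^ (k + 1 + 1)
        = (‖∑ x, χ (F x)‖ ^ 2) ^ (2 ^ k) * (Fintype.card G : ℝ) ^ (k + 1 + 1) := by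
          rw [← pow_mul]; ring_nf
      _ ≤ (∑ h, ‖∑ x, χ (gsDlt F h x)‖) ^ (2 ^ k) * (Fintype.card G : ℝ) ^ (k + 1 + 1) := by
          gcongr
      _ ≤ ((Fintype.card G : ℝ) ^ m * ∑ h, ‖∑ x, χ (gsDlt F h x)‖ ^ (2 ^ k)) *
            (Fintype.card G : ℝ) ^ (k + 1 + 1) := by gcongr
      _ = (Fintype.card G : ℝ) ^ (m + 1) * ∑ h, (‖∑ x, χ (gsDlt F h x)‖ ^ (2 ^ k) *
            (Fintype.card G : ℝ) ^ (k + 1)) := by rw [← Finset.sum_mul]; ring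
      _ ≤ (Fintype.card G : ℝ) ^ (m + 1) * ∑ h, ((Fintype.card G : ℝ) ^ (2 ^ k) *
            ∑ h' : Fin k → G, ‖∑ x, χ (gsIterDlt k h' (gsDlt F h) x)‖) := by
          refine mul_le_mul_of_nonneg_left (Finset.sum_le_sum fun h _ => ih _) (by positivity)
      _ = _ := by
          rw [← hm, ← Finset.mul_sum, ← mul_assoc, ← pow_add, ← two_mul, ← pow_succ']
          simp [gsIterDlt]


/-- All monomials of `f` have degree less than `e`. -/
def gsLt {σ A : Type*} [CommRing A] (e : ℕ) (f : MvPolynomial σ A) : Prop :=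
  ∀ m, e ≤ m.degree → coeff m f = 0

section gsLtLemmas
variable {σ A : Type*} [CommRing A]

lemma gsLt.mono {e e' : ℕ} {f : MvPolynomial σ A} (h : gsLt e f) (he : e ≤ e') : gsLt e' f :=
  fun m hm => h m (he.trans hm)
lemma gsLt_zero {e : ℕ} : gsLt e (0 : MvPolynomial σ A) := fun m _ => by simp
lemma gsLt.add {e : ℕ} {f g : MvPolynomial σ A} (hf : gsLt e f) (hg : gsLt e g) :
    gsLt e (f + g) := fun m hm => by rw [coeff_add, hf m hm, hg m hm, add_zero]
lemma gsLt.sum {ι : Type*} {e : ℕ} (s : Finset ι) {f : ι → MvPolynomial σ A}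
    (hf : ∀ i ∈ s, gsLt e (f i)) : gsLt e (∑ i ∈ s, f i) := fun m hm => by
  rw [coeff_sum]; exact Finset.sum_eq_zero fun i hi => hf i hi m hm
lemma gsLt.C_mul {e : ℕ} {f : MvPolynomial σ A} (hf : gsLt e f) (a : A) :
    gsLt e (C a * f) := fun m hm => by rw [coeff_C_mul, hf m hm, mul_zero]
lemma gsLt.X_mul {e : ℕ} {f : MvPolynomial σ A} (hf : gsLt e f) (i : σ) :
    gsLt (e + 1) (X i * f) := fun m hm => by
  classical
  rw [coeff_X_mul']
  split_ifs with h
  · apply hf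
    have h1 : m = (m - Finsupp.single i 1) + Finsupp.single i 1 := by
      refine (tsub_add_cancel_of_le ?_).symm
      rw [Finsupp.single_le_iff]
      exact Nat.one_le_iff_ne_zero.mpr (by simpa using h)
    rw [h1, map_add, Finsupp.degree_single] at hm
    omega
  · rfl
lemma gsLt.pderiv {e : ℕ} {f : MvPolynomial σ A} (hf : gsLt e f) (i : σ) :
    gsLt (e - 1) (pderiv i f) := fun m hm => by
  rw [coeff_pderiv, hf, zero_mul]
  rw [map_add, Finsupp.degree_single]; omega

end gsLtLemmas

lemma gs_split {σ : Type*} {m : σ →₀ ℕ} {N : ℕ} (hm : m.degree = N + 1) :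
    ∃ (i : σ) (m' : σ →₀ ℕ), m = Finsupp.single i 1 + m' ∧ m'.degree = N := by
  have hm0 : m ≠ 0 := by rintro rfl; simp at hm
  obtain ⟨i, hi⟩ := Finsupp.ne_iff.mp hm0
  have h1 : m = Finsupp.single i 1 + (m - Finsupp.single i 1) := by
    refine (add_tsub_cancel_of_le ?_).symm
    rw [Finsupp.single_le_iff]
    exact Nat.one_le_iff_ne_zero.mpr (by simpa using hi)
  refine ⟨i, _, h1, ?_⟩
  rw [h1, map_add, Finsupp.degree_single] at hm; omega

section gsTaylor
variable {n : ℕ} {A : Type*} [CommRing A]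

/-- Polynomial forward difference. -/
def gsDl (h : Fin n → A) : MvPolynomial (Fin n) A →ₗ[A] MvPolynomial (Fin n) A :=
  (aeval (fun i => X i + C (h i)) : MvPolynomial (Fin n) A →ₐ[A] MvPolynomial (Fin n) A).toLinearMap
    - LinearMap.id

/-- Directional derivative. -/
def gsDd (h : Fin n → A) : MvPolynomial (Fin n) A →ₗ[A] MvPolynomial (Fin n) A :=
  ∑ i, h i • (pderiv i : Derivation A (MvPolynomial (Fin n) A) (MvPolynomial (Fin n) A)).toLinearMap

lemma gsDl_apply (h : Fin n → A) (f : MvPolynomial (Fin n) A) :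
    gsDl h f = aeval (fun i => X i + C (h i)) f - f := rfl

lemma gsDd_apply (h : Fin n → A) (f : MvPolynomial (Fin n) A) :
    gsDd h f = ∑ i, h i • pderiv i f := by simp [gsDd]

lemma gsLt.gsDd {e : ℕ} {f : MvPolynomial (Fin n) A} (hf : gsLt e f) (h : Fin n → A) :
    gsLt (e - 1) (gsDd h f) := by
  rw [gsDd_apply]
  refine gsLt.sum _ fun i _ => ?_
  rw [smul_eq_C_mul]
  exact (hf.pderiv i).C_mul _

lemma gsDl_eval (h x : Fin n → A) (f : MvPolynomial (Fin n) A) :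
    eval x (gsDl h f) = eval (x + h) f - eval x f := by
  rw [gsDl_apply, map_sub]
  congr 1
  induction f using MvPolynomial.induction_on with
  | C a => simp
  | add p q hp hq => rw [map_add, map_add, map_add, hp, hq]
  | mul_X p i hp => rw [map_mul, map_mul, map_mul, hp]; simp

lemma gsDl_mul_X (h : Fin n → A) (f : MvPolynomial (Fin n) A) (i : Fin n) :
    gsDl h (X i * f) = X i * gsDl h f + C (h i) * gsDl h f + C (h i) * f := by
  simp only [gsDl_apply, map_mul, aeval_X]; ring

lemma gsDd_mul_X (h : Fin n → A) (f : MvPolynomial (Fin n) A) (i : Fin n) :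
    gsDd h (X i * f) = X i * gsDd h f + C (h i) * f := by
  simp only [gsDd_apply, Derivation.leibniz, smul_add, Finset.sum_add_distrib, smul_eq_mul,
    Finset.mul_sum, pderiv_X, smul_eq_C_mul]
  congr 1
  · exact Finset.sum_congr rfl fun j _ => by ring
  · rw [Finset.sum_eq_single i]
    · simp
    · intro j _ hj; simp [hj.symm]
    · simp

lemma gs_taylor_monomial (h : Fin n → A) (a : A) (N : ℕ) : ∀ m : Fin n →₀ ℕ, m.degree = N →
    gsLt N (gsDl h (monomial m a)) ∧
    gsLt (N - 1) (gsDl h (monomial m a) - gsDd h (monomial m a)) ∧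
    gsLt (N + 1) (monomial m a) := by
  induction N with
  | zero =>
    intro m hm
    have : m = 0 := (Finsupp.degree_eq_zero_iff m).mp hm
    subst this
    have h1 : gsDl h (monomial 0 a) = 0 := by rw [gsDl_apply]; simp [← C_apply]
    have h2 : gsDd h (monomial 0 a) = 0 := by rw [gsDd_apply]; simp [← C_apply]
    rw [h1, h2]
    refine ⟨gsLt_zero, by simpa using gsLt_zero, fun m hm => ?_⟩
    rw [coeff_monomial, if_neg]
    rintro rfl; simp at hm
  | succ N ih =>
    intro m hm
    obtain ⟨i, m', h1, hd⟩ := gs_split hm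
    have h2 : monomial m a = X i * monomial m' a := by
      rw [h1, X, monomial_mul, one_mul]
    obtain ⟨i1, i2, i3⟩ := ih m' hd
    rw [h2]
    refine ⟨?_, ?_, i3.X_mul i⟩
    · rw [gsDl_mul_X]
      exact ((i1.X_mul i).add ((i1.C_mul _).mono (by omega))).add (i3.C_mul _)
    · rw [gsDl_mul_X, gsDd_mul_X]
      have : X i * gsDl h (monomial m' a) + C (h i) * gsDl h (monomial m' a) +
          C (h i) * monomial m' a - (X i * gsDd h (monomial m' a) + C (h i) * monomial m' a) =
          X i * (gsDl h (monomial m' a) - gsDd h (monomial m' a)) +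
            C (h i) * gsDl h (monomial m' a) := by ring
      rw [this]
      refine gsLt.add ?_ (i1.C_mul _)
      rcases Nat.eq_zero_or_pos N with rfl | hN
      · have : gsDl h (monomial m' a) - gsDd h (monomial m' a) = 0 := by
          ext m; rw [i2 m (by simp)]; simp
        rw [this]; simpa using gsLt_zero
      · exact (i2.X_mul i).mono (by omega)

lemma gs_taylor {e : ℕ} {f : MvPolynomial (Fin n) A} (hf : gsLt e f) (h : Fin n → A) :
    gsLt (e - 1) (gsDl h f) ∧ gsLt (e - 2) (gsDl h f - gsDd h f) := by
  have key : ∀ m ∈ f.support, m.degree + 1 ≤ e := by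
    intro m hm
    by_contra hlt
    exact (mem_support_iff.mp hm) (hf m (by omega))
  constructor
  · conv => rw [f.as_sum]
    rw [map_sum]
    refine gsLt.sum _ fun m hm => ?_
    exact ((gs_taylor_monomial h _ _ m rfl).1).mono (by have := key m hm; omega)
  · conv => rw [f.as_sum]
    rw [map_sum, map_sum, ← Finset.sum_sub_distrib]
    refine gsLt.sum _ fun m hm => ?_
    exact ((gs_taylor_monomial h _ _ m rfl).2.1).mono (by have := key m hm; omega)

/-- Iterated polynomial differences. -/
def gsIterDl : (k : ℕ) → (Fin k → Fin n → A) → MvPolynomial (Fin n) A → MvPolynomial (Fin n) A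
  | 0, _, f => f
  | k + 1, h, f => gsIterDl k (Fin.tail h) (gsDl (h 0) f)

/-- Iterated directional derivatives. -/
def gsIterDd : (k : ℕ) → (Fin k → Fin n → A) → MvPolynomial (Fin n) A → MvPolynomial (Fin n) A
  | 0, _, f => f
  | k + 1, h, f => gsIterDd k (Fin.tail h) (gsDd (h 0) f)

lemma gsIterDl_add (k : ℕ) : ∀ (h : Fin k → Fin n → A) (f g : MvPolynomial (Fin n) A),
    gsIterDl k h (f + g) = gsIterDl k h f + gsIterDl k h g := by
  induction k with
  | zero => intro h f g; rfl
  | succ k ih => intro h f g; simp only [gsIterDl, map_add, ih]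

lemma gsIterDl_lt (k : ℕ) : ∀ (h : Fin k → Fin n → A) (f : MvPolynomial (Fin n) A) (e : ℕ),
    gsLt e f → gsLt (e - k) (gsIterDl k h f) := by
  induction k with
  | zero => intro h f e hf; exact hf
  | succ k ih =>
    intro h f e hf
    exact (ih _ _ _ (gs_taylor hf (h 0)).1).mono (by omega)

lemma gsIterDl_sub_lt (k : ℕ) : ∀ (h : Fin k → Fin n → A) (f : MvPolynomial (Fin n) A) (e : ℕ),
    gsLt e f → gsLt (e - k - 1) (gsIterDl k h f - gsIterDd k h f) := by
  induction k with
  | zero => intro h f e hf; simpa [gsIterDl, gsIterDd] using gsLt_zero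
  | succ k ih =>
    intro h f e hf
    simp only [gsIterDl, gsIterDd]
    have h1 : gsIterDl k (Fin.tail h) (gsDl (h 0) f) =
        gsIterDl k (Fin.tail h) (gsDl (h 0) f - gsDd (h 0) f) +
          gsIterDl k (Fin.tail h) (gsDd (h 0) f) := by
      rw [← gsIterDl_add, sub_add_cancel]
    rw [h1, add_sub_assoc]
    refine gsLt.add ?_ ?_
    · exact (gsIterDl_lt k _ _ _ (gs_taylor hf (h 0)).2).mono (by omega)
    · exact (ih _ _ _ (hf.gsDd (h 0))).mono (by omega)

lemma gsIterDd_lt (k : ℕ) : ∀ (h : Fin k → Fin n → A) (f : MvPolynomial (Fin n) A) (e : ℕ),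
    gsLt e f → gsLt (e - k) (gsIterDd k h f) := by
  induction k with
  | zero => intro h f e hf; exact hf
  | succ k ih =>
    intro h f e hf
    exact (ih _ _ _ (hf.gsDd (h 0))).mono (by omega)

lemma gs_affine {f : MvPolynomial (Fin n) A} (hf : gsLt 2 f) (x : Fin n → A) :
    eval x f = coeff 0 f + ∑ j, x j * coeff 0 (pderiv j f) := by
  have h1 : f = C (coeff 0 f) + ∑ j, C (coeff 0 (pderiv j f)) * X j := by
    ext m
    rw [coeff_add, coeff_sum]
    simp only [coeff_C_mul, coeff_C, coeff_X, coeff_pderiv]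
    by_cases h2 : 2 ≤ m.degree
    · rw [hf m h2, if_neg, zero_add, eq_comm]
      · refine Finset.sum_eq_zero fun j _ => ?_
        rw [if_neg, mul_zero]
        rintro rfl; rw [Finsupp.degree_single] at h2; omega
      · rintro rfl; simp at h2
    · by_cases h0 : m.degree = 0
      · have : m = 0 := (Finsupp.degree_eq_zero_iff m).mp h0
        subst this
        simp
      · have h3 : m.degree = 1 := by omega
        obtain ⟨i, rfl⟩ : ∃ i, m = Finsupp.single i 1 := by
          obtain ⟨i, m', rfl, hm'⟩ := gs_split h3
          rw [Finsupp.degree_eq_zero_iff] at hm'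
          exact ⟨i, by rw [hm', add_zero]⟩
        rw [if_neg (by intro h; have := congrArg Finsupp.degree h; simp at this), zero_add,
          Finset.sum_eq_single i]
        · simp
        · intro j _ hj
          rw [if_neg, mul_zero]
          intro h
          exact hj (Finsupp.single_left_injective one_ne_zero h)
        · simp
  conv_lhs => rw [h1]
  simp only [map_add, map_sum, map_mul, eval_C, eval_X]
  congr 1
  exact Finset.sum_congr rfl fun j _ => mul_comm _ _

/-- Iterated partial derivatives. -/
def gsIterP : (k : ℕ) → (Fin k → Fin n) → MvPolynomial (Fin n) A → MvPolynomial (Fin n) A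
  | 0, _, f => f
  | k + 1, I, f => gsIterP k (Fin.tail I) (pderiv (I 0) f)

/-- The coefficients of the polarization of `f`. -/
def gsTens (k : ℕ) (f : MvPolynomial (Fin n) A) (I : Fin k → Fin n) (j : Fin n) : A :=
  coeff 0 (gsIterP k I (pderiv j f))

lemma gsIterP_add (k : ℕ) : ∀ (I : Fin k → Fin n) (f g : MvPolynomial (Fin n) A),
    gsIterP k I (f + g) = gsIterP k I f + gsIterP k I g := by
  induction k with
  | zero => intro h f g; rfl
  | succ k ih => intro h f g; simp only [gsIterP, map_add, ih]

lemma gsIterP_smul (k : ℕ) : ∀ (I : Fin k → Fin n) (a : A) (f : MvPolynomial (Fin n) A),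
    gsIterP k I (a • f) = a • gsIterP k I f := by
  induction k with
  | zero => intro h f g; rfl
  | succ k ih => intro h f g; simp only [gsIterP, Derivation.map_smul, ih]

lemma gsIterDd_add (k : ℕ) : ∀ (I : Fin k → Fin n → A) (f g : MvPolynomial (Fin n) A),
    gsIterDd k I (f + g) = gsIterDd k I f + gsIterDd k I g := by
  induction k with
  | zero => intro h f g; rfl
  | succ k ih => intro h f g; simp only [gsIterDd, map_add, ih]

lemma gsIterDd_smul (k : ℕ) : ∀ (I : Fin k → Fin n → A) (a : A) (f : MvPolynomial (Fin n) A),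
    gsIterDd k I (a • f) = a • gsIterDd k I f := by
  induction k with
  | zero => intro h f g; rfl
  | succ k ih => intro h f g; simp only [gsIterDd, map_smul, ih]

lemma gsIterDd_sum {ι : Type*} (k : ℕ) (I : Fin k → Fin n → A) (s : Finset ι)
    (f : ι → MvPolynomial (Fin n) A) :
    gsIterDd k I (∑ i ∈ s, f i) = ∑ i ∈ s, gsIterDd k I (f i) := by
  classical
  induction s using Finset.induction_on with
  | empty => simpa using gsIterDd_smul k I 0 0
  | insert a s ha ih => rw [Finset.sum_insert ha, Finset.sum_insert ha, gsIterDd_add, ih]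

lemma gs_pderiv_comm (i j : Fin n) (f : MvPolynomial (Fin n) A) :
    pderiv i (pderiv j f) = pderiv j (pderiv i f) := by
  ext m
  simp only [coeff_pderiv]
  by_cases h : i = j
  · subst h; rfl
  · rw [add_right_comm]
    simp [h, Ne.symm h]
    ring

lemma gs_pderiv_iterDd (k : ℕ) (j : Fin n) : ∀ (h : Fin k → Fin n → A) (f : MvPolynomial (Fin n) A),
    pderiv j (gsIterDd k h f) = gsIterDd k h (pderiv j f) := by
  induction k with
  | zero => intro h f; rfl
  | succ k ih =>
    intro h f
    simp only [gsIterDd, ih]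
    congr 1
    simp only [gsDd_apply, map_sum, Derivation.map_smul]
    exact Finset.sum_congr rfl fun i _ => by rw [gs_pderiv_comm]

lemma gsIterDd_eq (k : ℕ) : ∀ (h : Fin k → Fin n → A) (f : MvPolynomial (Fin n) A),
    gsIterDd k h f = ∑ I : Fin k → Fin n, (∏ t, h t (I t)) • gsIterP k I f := by
  induction k with
  | zero => intro h f; simp [gsIterDd, gsIterP]
  | succ k ih =>
    intro h f
    rw [gs_sum_cons (M := MvPolynomial (Fin n) A), gsIterDd, gsDd_apply, gsIterDd_sum]
    simp only [gsIterP, ih]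
    refine Finset.sum_congr rfl fun i _ => ?_
    refine Finset.sum_congr rfl fun I _ => ?_
    simp [gsIterP_smul, Fin.prod_univ_succ, smul_smul, Fin.tail, mul_comm]

lemma gsIterDlt_eval (k : ℕ) : ∀ (h : Fin k → Fin n → A) (f : MvPolynomial (Fin n) A),
    gsIterDlt k h (fun x => eval x f) = fun x => eval x (gsIterDl k h f) := by
  induction k with
  | zero => intro h f; rfl
  | succ k ih =>
    intro h f
    simp only [gsIterDlt, gsIterDl]
    rw [← ih]
    congr 1
    funext x
    rw [gsDl_eval]; rfl

/-- The iterated difference of a polynomial of degree at most `k+1` is affine. -/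
lemma gs_iterDlt_affine (k : ℕ) (h : Fin k → Fin n → A) (f : MvPolynomial (Fin n) A)
    (hf : gsLt (k + 2) f) : ∃ c : A, ∀ x, gsIterDlt k h (fun x => eval x f) x =
      c + ∑ j, x j * ∑ I : Fin k → Fin n, gsTens k f I j * ∏ t, h t (I t) := by
  rw [gsIterDlt_eval]
  have h1 : gsLt 2 (gsIterDl k h f) := (gsIterDl_lt k h f _ hf).mono (by omega)
  have h2 := gsIterDl_sub_lt k h f _ hf
  refine ⟨coeff 0 (gsIterDl k h f), fun x => ?_⟩
  beta_reduce
  rw [gs_affine h1]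
  congr 1
  refine Finset.sum_congr rfl fun j _ => ?_
  congr 1
  have h3 : pderiv j (gsIterDl k h f) = pderiv j (gsIterDd k h f) := by
    have := (h2.pderiv j)
    have h0 : pderiv j (gsIterDl k h f - gsIterDd k h f) = 0 := by
      ext m; rw [this m (by omega)]; simp
    rwa [map_sub, sub_eq_zero] at h0
  rw [h3, gs_pderiv_iterDd, gsIterDd_eq, coeff_sum]
  refine Finset.sum_congr rfl fun I _ => ?_
  rw [coeff_smul, smul_eq_mul, mul_comm]; rfl

end gsTaylor


/-- The polarized gradient of `f`. -/
def gsPsi {n : ℕ} {A A' : Type*} [CommRing A] [CommRing A'] [Algebra A A'] (k : ℕ)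
    (f : MvPolynomial (Fin n) A) (h : Fin k → Fin n → A') (j : Fin n) : A' :=
  ∑ I : Fin k → Fin n, algebraMap A A' (gsTens k f I j) * ∏ t, h t (I t)

lemma gs_char_sum {n q : ℕ} [NeZero q] (c : ZMod q) (w : Fin n → ZMod q) (hw : w ≠ 0) :
    ∑ x : Fin n → ZMod q, ZMod.stdAddChar (c + ∑ j, x j * w j) = 0 := by
  simp_rw [AddChar.map_add_eq_mul]
  rw [← Finset.mul_sum]
  let L : (Fin n → ZMod q) →+ ZMod q :=
    { toFun := fun x => ∑ j, x j * w j
      map_zero' := by simp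
      map_add' := fun x y => by simp [add_mul, Finset.sum_add_distrib] }
  have : ∑ x : Fin n → ZMod q, (ZMod.stdAddChar.compAddMonoidHom L) x = 0 := by
    apply AddChar.sum_eq_zero_of_ne_one
    intro h1
    obtain ⟨j, hj⟩ := Function.ne_iff.mp hw
    have h2 := DFunLike.congr_fun h1 (Pi.single j 1)
    have h3 : L (Pi.single j 1) = w j := by
      change ∑ i, (Pi.single j 1 : Fin n → ZMod q) i * w i = w j
      rw [Finset.sum_eq_single j] <;> simp +contextual
    rw [AddChar.compAddMonoidHom_apply, h3, AddChar.one_apply,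
      ← AddChar.map_zero_eq_one (ZMod.stdAddChar (N := q))] at h2
    exact hj (ZMod.injective_stdAddChar h2)
  rw [show ∑ x : Fin n → ZMod q, ZMod.stdAddChar (∑ j, x j * w j) =
    ∑ x : Fin n → ZMod q, (ZMod.stdAddChar.compAddMonoidHom L) x from rfl, this, mul_zero]

open Classical in
lemma gs_weyl_zmod {n q k : ℕ} [NeZero q] (f : MvPolynomial (Fin n) (ZMod q))
    (hf : gsLt (k + 2) f) :
    ‖∑ x : Fin n → ZMod q, ZMod.stdAddChar (eval x f)‖ ^ (2 ^ k) * ((q : ℝ) ^ n) ^ k ≤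
      ((q : ℝ) ^ n) ^ (2 ^ k) *
        ((Finset.univ.filter fun h : Fin k → Fin n → ZMod q => gsPsi k f h = 0).card : ℝ) := by
  have h1 := gs_weyl (G := Fin n → ZMod q) ZMod.stdAddChar k (fun x => eval x f)
  have hc : (Fintype.card (Fin n → ZMod q) : ℝ) = (q : ℝ) ^ n := by simp [ZMod.card]
  rw [hc] at h1
  have hq : (0:ℝ) < (q : ℝ) ^ n := by
    have : 0 < q := Nat.pos_of_ne_zero (NeZero.ne q)
    positivity
  have h2 : ∑ h : Fin k → Fin n → ZMod q,
      ‖∑ x, ZMod.stdAddChar (gsIterDlt k h (fun x => eval x f) x)‖ ≤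
      (q : ℝ) ^ n * ((Finset.univ.filter fun h : Fin k → Fin n → ZMod q => gsPsi k f h = 0).card : ℝ) := by
    rw [Finset.card_filter]
    push_cast
    rw [Finset.mul_sum]
    refine Finset.sum_le_sum fun h _ => ?_
    obtain ⟨c, hcc⟩ := gs_iterDlt_affine k h f hf
    split_ifs with h0
    · calc ‖∑ x, ZMod.stdAddChar (gsIterDlt k h (fun x => eval x f) x)‖
          ≤ ∑ x : Fin n → ZMod q, ‖ZMod.stdAddChar (gsIterDlt k h (fun x => eval x f) x)‖ := norm_sum_le _ _
        _ = (q : ℝ) ^ n * 1 := by simp [ZMod.card]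
    · simp_rw [hcc]
      rw [gs_char_sum c _ (fun h' => h0 (by rw [← h']; rfl))]
      simp
  have h3 := h1.trans (mul_le_mul_of_nonneg_left h2 (by positivity))
  rw [pow_succ, ← mul_assoc] at h3
  refine le_of_mul_le_mul_right (h3.trans_eq ?_) hq
  ring

lemma gsIterP_map {n : ℕ} {A B : Type*} [CommRing A] [CommRing B] (φ : A →+* B) (k : ℕ) :
    ∀ (I : Fin k → Fin n) (f : MvPolynomial (Fin n) A),
    gsIterP k I (map φ f) = map φ (gsIterP k I f) := by
  induction k with
  | zero => intro I f; rfl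
  | succ k ih => intro I f; simp only [gsIterP, pderiv_map, ih]

lemma gsTens_map {n : ℕ} {A B : Type*} [CommRing A] [CommRing B] (φ : A →+* B) (k : ℕ)
    (I : Fin k → Fin n) (f : MvPolynomial (Fin n) A) (j : Fin n) :
    gsTens k (map φ f) I j = φ (gsTens k f I j) := by
  simp only [gsTens, pderiv_map, gsIterP_map, coeff_map]

lemma gsPsi_map {n : ℕ} {A B : Type*} [CommRing A] [CommRing B] (φ : A →+* B) (k : ℕ)
    (f : MvPolynomial (Fin n) A) (h : Fin k → Fin n → A) (j : Fin n) :
    gsPsi k (map φ f) (fun t i => φ (h t i)) j = φ (gsPsi k f h j) := by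
  simp [gsPsi, gsTens_map]

lemma gsTens_add {n : ℕ} {A : Type*} [CommRing A] (k : ℕ)
    (I : Fin k → Fin n) (f g : MvPolynomial (Fin n) A) (j : Fin n) :
    gsTens k (f + g) I j = gsTens k f I j + gsTens k g I j := by
  simp [gsTens, gsIterP_add]

lemma gsTens_smul {n : ℕ} {A : Type*} [CommRing A] (k : ℕ)
    (I : Fin k → Fin n) (a : A) (g : MvPolynomial (Fin n) A) (j : Fin n) :
    gsTens k (a • g) I j = a * gsTens k g I j := by
  simp only [gsTens, Derivation.map_smul, gsIterP_smul, coeff_smul, smul_eq_mul]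

lemma gsTens_sum {n : ℕ} {A ι : Type*} [CommRing A] (k : ℕ)
    (I : Fin k → Fin n) (s : Finset ι) (a : ι → A) (g : ι → MvPolynomial (Fin n) A) (j : Fin n) :
    gsTens k (∑ i ∈ s, a i • g i) I j = ∑ i ∈ s, a i * gsTens k (g i) I j := by
  classical
  induction s using Finset.induction_on with
  | empty => simpa using gsTens_smul k I (0 : A) 0 j
  | insert b s hb ih => rw [Finset.sum_insert hb, Finset.sum_insert hb, gsTens_add, ih, gsTens_smul]

lemma gsPsi_sum {n : ℕ} {A ι : Type*} [CommRing A] (k : ℕ)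
    (s : Finset ι) (a : ι → A) (g : ι → MvPolynomial (Fin n) A) (h : Fin k → Fin n → A) (j : Fin n) :
    gsPsi k (∑ i ∈ s, a i • g i) h j = ∑ i ∈ s, a i * gsPsi k (g i) h j := by
  simp only [gsPsi, gsTens_sum, Finset.mul_sum, map_sum, Finset.sum_mul, Algebra.algebraMap_self,
    RingHom.id_apply]
  rw [Finset.sum_comm]
  exact Finset.sum_congr rfl fun i _ => Finset.sum_congr rfl fun j _ => by ring

lemma gs_eC_eq {q : ℕ} [NeZero q] (m : ℤ) : eC ((m : ℝ) / q) = ZMod.stdAddChar (m : ZMod q) := by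
  rw [ZMod.stdAddChar_coe, eC]
  congr 1
  push_cast
  ring

lemma gs_finEquiv (q : ℕ) [NeZero q] (y : Fin q) : ZMod.finEquiv q y = ((y : ℕ) : ZMod q) := by
  cases q with
  | zero => exact y.elim0
  | succ q => exact (ZMod.natCast_zmod_val (n := q + 1) y).symm

open Classical in
/-- Weyl differencing for complete exponential sums. -/
lemma gs_weyl_int {n q k : ℕ} (hq : 0 < q) (f : MvPolynomial (Fin n) ℤ) (hf : gsLt (k + 2) f) :
    ‖∑ x : Fin n → Fin q, eC ((eval (fun j => ((x j : ℕ) : ℤ)) f : ℝ) / q)‖ ^ (2 ^ k) *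
      ((q : ℝ) ^ n) ^ k ≤
      ((q : ℝ) ^ n) ^ (2 ^ k) *
        (((Fintype.piFinset fun _ : Fin k => Fintype.piFinset fun _ : Fin n =>
          Finset.Ico (0 : ℤ) q).filter
            fun h => (fun j => ((gsPsi k f h j : ℤ) : ZMod q)) = 0).card : ℝ) := by
  have : NeZero q := ⟨hq.ne'⟩
  have h1 := gs_weyl_zmod (k := k) (map (Int.castRingHom (ZMod q)) f)
    (fun m hm => by rw [coeff_map, hf m hm, map_zero])
  have h2 : ∑ x : Fin n → Fin q, eC ((eval (fun j => ((x j : ℕ) : ℤ)) f : ℝ) / q) =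
      ∑ x : Fin n → ZMod q, ZMod.stdAddChar (eval x (map (Int.castRingHom (ZMod q)) f)) := by
    refine Fintype.sum_equiv (Equiv.piCongrRight fun _ => (ZMod.finEquiv q).toEquiv) _ _ fun x => ?_
    rw [gs_eC_eq]
    congr 1
    rw [eval_map, ← eq_intCast (Int.castRingHom (ZMod q)), ← eval₂_id, hom_eval₂]
    congr 1
    funext j
    have h4 := gs_finEquiv q (x j)
    simpa using h4.symm
  rw [h2]
  refine h1.trans (mul_le_mul_of_nonneg_left ?_ (by positivity))
  norm_cast
  refine Finset.card_le_card_of_injOn (fun h t i => ((h t i).val : ℤ)) ?_ ?_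
  · intro h hh
    simp only [Finset.coe_filter, Finset.mem_univ, true_and, Set.mem_ofPred_eq,
      Fintype.mem_piFinset, Finset.mem_Ico] at hh ⊢
    refine ⟨fun t i => ⟨by positivity, by exact_mod_cast ZMod.val_lt _⟩, ?_⟩
    rw [← hh]
    funext j
    rw [← eq_intCast (Int.castRingHom (ZMod q)), ← gsPsi_map]
    simp
  · intro h _ h' _ hh
    funext t i
    have := congrFun (congrFun hh t) i
    exact ZMod.val_injective q (Int.ofNat.inj this)


/-- The box `[0,q)^n`. -/
def gsBoxQ (n q : ℕ) : Finset (Fin n → ℤ) := Fintype.piFinset fun _ => Finset.Ico (0 : ℤ) q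
/-- The box `(-B,B)^n`. -/
def gsBoxB (n B : ℕ) : Finset (Fin n → ℤ) := Fintype.piFinset fun _ => Finset.Ioo (-(B : ℤ)) B

open Classical in
lemma gs_pigeon {n q B c : ℕ} (hB : 0 < B) (hc : q ≤ c * B) {W : Type*} [AddCommGroup W]
    (φ : (Fin n → ℤ) → W) (hφ : ∀ u v, φ (u - v) = φ u - φ v) :
    ((gsBoxQ n q).filter fun v => φ v = 0).card ≤
      c ^ n * ((gsBoxB n B).filter fun v => φ v = 0).card := by
  have hB' : (0:ℤ) < B := by exact_mod_cast hB
  have := Finset.card_le_mul_card_image_of_maps_to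
    (s := (gsBoxQ n q).filter fun v => φ v = 0)
    (t := Fintype.piFinset fun _ : Fin n => Finset.Ico (0:ℤ) c)
    (f := fun v i => v i / (B : ℤ)) ?_ ((gsBoxB n B).filter fun v => φ v = 0).card ?_
  · rw [Fintype.card_piFinset] at this
    simp at this
    rw [mul_comm]; exact this
  · intro v hv
    simp only [gsBoxQ, Finset.mem_filter, Fintype.mem_piFinset, Finset.mem_Ico] at hv ⊢
    intro i
    refine ⟨Int.ediv_nonneg (hv.1 i).1 hB'.le, ?_⟩
    apply Int.ediv_lt_of_lt_mul hB'
    have h2 : (q : ℤ) ≤ c * B := by exact_mod_cast hc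
    exact (hv.1 i).2.trans_le h2
  · intro b hb
    by_cases hne : (((gsBoxQ n q).filter fun v => φ v = 0).filter
        fun v => (fun i => v i / (B : ℤ)) = b).Nonempty
    · obtain ⟨v0, hv0⟩ := hne
      refine Finset.card_le_card_of_injOn (fun v => v - v0) ?_ ?_
      · intro v hv
        simp only [Finset.coe_filter, Set.mem_ofPred_eq, Finset.mem_filter, gsBoxB,
          Fintype.mem_piFinset, Finset.mem_Ioo] at hv hv0 ⊢
        refine ⟨fun i => ?_, by rw [hφ, hv.1.2, hv0.1.2, sub_zero]⟩
        have h1 : v i / (B : ℤ) = v0 i / (B : ℤ) := by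
          have e1 := congrFun hv.2 i
          have e2 := congrFun hv0.2 i
          exact e1.trans e2.symm
        have h2 := Int.mul_ediv_add_emod (v i) B
        have h3 := Int.mul_ediv_add_emod (v0 i) B
        have h4 := Int.emod_nonneg (v i) hB'.ne'
        have h5 := Int.emod_nonneg (v0 i) hB'.ne'
        have h6 := Int.emod_lt_of_pos (v i) hB'
        have h7 := Int.emod_lt_of_pos (v0 i) hB'
        rw [h1] at h2
        simp only [Pi.sub_apply]
        constructor <;> linarith
      · intro u _ v _ h
        exact sub_left_injective h
    · rw [Finset.not_nonempty_iff_eq_empty] at hne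
      rw [hne]; simp

open Classical in
/-- Counting by slicing off the first vector. -/
lemma gs_card_cons {α : Type*} [DecidableEq α] (k : ℕ) (S : Finset α) (P : (Fin (k+1) → α) → Prop) :
    ((Fintype.piFinset fun _ : Fin (k+1) => S).filter P).card =
      ∑ v ∈ S, ((Fintype.piFinset fun _ : Fin k => S).filter fun h => P (Fin.cons v h)).card := by
  rw [← Finset.card_sigma]
  refine Finset.card_bij' (fun h _ => ⟨h 0, Fin.tail h⟩) (fun x _ => Fin.cons x.1 x.2) ?_ ?_ ?_ ?_
  · intro h hh
    simp only [Finset.mem_filter, Fintype.mem_piFinset, Finset.mem_sigma] at hh ⊢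
    exact ⟨hh.1 0, fun i => hh.1 _, by simpa using hh.2⟩
  · intro x hx
    simp only [Finset.mem_filter, Fintype.mem_piFinset, Finset.mem_sigma] at hx ⊢
    refine ⟨fun i => ?_, hx.2.2⟩
    refine Fin.cases ?_ (fun i => ?_) i
    · simpa using hx.1
    · simpa using hx.2.1 i
  · intro h _; simp
  · intro x _; simp

open Classical in
lemma gs_shrink {n q B c : ℕ} (hB : 0 < B) (hc : q ≤ c * B) {W : Type*} [AddCommGroup W]
    (k : ℕ) : ∀ (M : MultilinearMap ℤ (fun _ : Fin k => Fin n → ℤ) W),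
    ((Fintype.piFinset fun _ : Fin k => gsBoxQ n q).filter fun h => M h = 0).card ≤
      (c ^ n) ^ k * ((Fintype.piFinset fun _ : Fin k => gsBoxB n B).filter fun h => M h = 0).card := by
  induction k with
  | zero => intro M; simp
  | succ k ih =>
    intro M
    rw [gs_card_cons]
    calc ∑ v ∈ gsBoxQ n q, ((Fintype.piFinset fun _ : Fin k => gsBoxQ n q).filter
            fun h => M (Fin.cons v h) = 0).card
        ≤ ∑ v ∈ gsBoxQ n q, (c ^ n) ^ k * ((Fintype.piFinset fun _ : Fin k => gsBoxB n B).filter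
            fun h => M (Fin.cons v h) = 0).card :=
          Finset.sum_le_sum fun v _ => ih (M.curryLeft v)
      _ = (c ^ n) ^ k * ∑ v ∈ gsBoxQ n q, ∑ h ∈ (Fintype.piFinset fun _ : Fin k => gsBoxB n B),
            if M (Fin.cons v h) = 0 then 1 else 0 := by
          rw [Finset.mul_sum]; simp only [Finset.card_filter]
      _ = (c ^ n) ^ k * ∑ h ∈ (Fintype.piFinset fun _ : Fin k => gsBoxB n B),
            ((gsBoxQ n q).filter fun v => M (Fin.cons v h) = 0).card := by
          rw [Finset.sum_comm]; simp only [Finset.card_filter]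
      _ ≤ (c ^ n) ^ k * ∑ h ∈ (Fintype.piFinset fun _ : Fin k => gsBoxB n B),
            c ^ n * ((gsBoxB n B).filter fun v => M (Fin.cons v h) = 0).card := by
          refine Nat.mul_le_mul_left _ (Finset.sum_le_sum fun h _ => ?_)
          refine gs_pigeon hB hc (fun v => M (Fin.cons v h)) fun u v => ?_
          exact DFunLike.congr_fun (map_sub (M.curryLeft) u v) h
      _ = (c ^ n) ^ (k + 1) * ∑ h ∈ (Fintype.piFinset fun _ : Fin k => gsBoxB n B),
            ((gsBoxB n B).filter fun v => M (Fin.cons v h) = 0).card := by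
          rw [← Finset.mul_sum, pow_succ, mul_assoc]
      _ = _ := by
          rw [gs_card_cons]
          congr 1
          simp only [Finset.card_filter]
          rw [Finset.sum_comm]

/-- The polarized gradient modulo `q` as a multilinear map. -/
def gsPsiM {n : ℕ} (k q : ℕ) (f : MvPolynomial (Fin n) ℤ) :
    MultilinearMap ℤ (fun _ : Fin k => Fin n → ℤ) (Fin n → ZMod q) :=
  MultilinearMap.pi fun j => (Int.castAddHom (ZMod q)).toIntLinearMap.compMultilinearMap
    (∑ I : Fin k → Fin n, gsTens k f I j •
      (MultilinearMap.mkPiAlgebra ℤ (Fin k) ℤ).compLinearMap (fun t => LinearMap.proj (I t)))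

lemma gsPsiM_apply {n : ℕ} (k q : ℕ) (f : MvPolynomial (Fin n) ℤ) (h : Fin k → Fin n → ℤ) :
    gsPsiM k q f h = fun j => ((gsPsi k f h j : ℤ) : ZMod q) := by
  funext j
  simp [gsPsiM, gsPsi]

open Classical in
lemma gs_weyl_shrunk {n q k B c : ℕ} (hq : 0 < q) (hB : 0 < B) (hc : q ≤ c * B)
    (f : MvPolynomial (Fin n) ℤ) (hf : gsLt (k + 2) f) :
    ‖∑ x : Fin n → Fin q, eC ((eval (fun j => ((x j : ℕ) : ℤ)) f : ℝ) / q)‖ ^ (2 ^ k) *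
      ((q : ℝ) ^ n) ^ k ≤
      ((q : ℝ) ^ n) ^ (2 ^ k) * (((c : ℝ) ^ n) ^ k *
        (((Fintype.piFinset fun _ : Fin k => gsBoxB n B).filter
            fun h => ∀ j, (q : ℤ) ∣ gsPsi k f h j).card : ℝ)) := by
  refine (gs_weyl_int hq f hf).trans (mul_le_mul_of_nonneg_left ?_ (by positivity))
  have h1 := gs_shrink hB hc k (gsPsiM k q f)
  have h2 : ∀ h : Fin k → Fin n → ℤ, gsPsiM k q f h = 0 ↔ ∀ j, (q : ℤ) ∣ gsPsi k f h j := by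
    intro h
    rw [gsPsiM_apply, funext_iff]
    refine forall_congr' fun j => ?_
    simpa using ZMod.intCast_zmod_eq_zero_iff_dvd (gsPsi k f h j) q
  simp only [h2] at h1
  have h3 : ∀ h : Fin k → Fin n → ℤ, ((fun j => ((gsPsi k f h j : ℤ) : ZMod q)) = 0) ↔
      ∀ j, (q : ℤ) ∣ gsPsi k f h j := fun h => by rw [← gsPsiM_apply, h2]
  simp only [h3]
  exact_mod_cast h1


lemma gs_rank {R q T : ℕ} (a : Fin R → ℤ)
    (hgcd : Int.gcd (Finset.univ.gcd a) (q : ℤ) = 1) (W : Set (Fin R → ℤ))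
    (hT : ∀ w ∈ W, ∀ i, |w i| ≤ (T : ℤ)) (hdvd : ∀ w ∈ W, (q : ℤ) ∣ ∑ i, a i * w i)
    (hlt : R.factorial * T ^ R < q) :
    ∃ b : Fin R → ℤ, b ≠ 0 ∧ ∀ w ∈ W, ∑ i, b i * w i = 0 := by
  classical
  let cst : (Fin R → ℤ) → (Fin R → ℚ) := fun w i => (w i : ℚ)
  by_cases htop : Submodule.span ℚ (cst '' W) = ⊤
  · exfalso
    obtain ⟨v, hv1, -, hv3⟩ := Submodule.exists_fun_fin_finrank_span_eq ℚ (cst '' W)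
    have hfr : Module.finrank ℚ (Submodule.span ℚ (cst '' W)) = R := by
      rw [htop, finrank_top]; simp
    obtain ⟨e⟩ : Nonempty (Fin R ≃ Fin (Module.finrank ℚ (Submodule.span ℚ (cst '' W)))) :=
      ⟨finCongr hfr.symm⟩
    choose w hwW hw using fun i => hv1 (e i)
    let M : Matrix (Fin R) (Fin R) ℤ := Matrix.of w
    have hdet : M.det ≠ 0 := by
      have h1 : LinearIndependent ℚ (fun i => v (e i)) := hv3.comp _ e.injective
      have h2 : IsUnit (M.map (Int.castRingHom ℚ)) := by
        rw [← Matrix.linearIndependent_rows_iff_isUnit]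
        have h3 : (M.map (Int.castRingHom ℚ)).row = fun i => v (e i) := by
          funext i
          rw [← hw i]
          rfl
        rw [h3]
        exact h1
      rw [Matrix.isUnit_iff_isUnit_det] at h2
      intro h0
      have h3 : (M.map (Int.castRingHom ℚ)).det = 0 := by
        rw [← RingHom.mapMatrix_apply, ← RingHom.map_det, h0, map_zero]
      rw [h3] at h2
      exact not_isUnit_zero h2
    have hda : ∀ i, (q : ℤ) ∣ M.det * a i := by
      intro i
      have h1 : M.adjugate.mulVec (M.mulVec a) = M.det • a := by
        rw [Matrix.mulVec_mulVec, Matrix.adjugate_mul, Matrix.smul_mulVec, Matrix.one_mulVec]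
      have h2 := congrFun h1 i
      simp only [Pi.smul_apply, smul_eq_mul] at h2
      rw [← h2, Matrix.mulVec, dotProduct]
      refine Finset.dvd_sum fun j _ => Dvd.dvd.mul_left ?_ _
      have h3 := hdvd _ (hwW j)
      rw [Matrix.mulVec, dotProduct]
      refine h3.trans (dvd_of_eq (Finset.sum_congr rfl fun i _ => ?_))
      simp [M, mul_comm]
    have hd : (q : ℤ) ∣ M.det := by
      have h1 : (q : ℤ) ∣ Finset.univ.gcd (fun i => M.det * a i) := Finset.dvd_gcd fun i _ => hda i
      rw [Finset.gcd_mul_left] at h1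
      have h2 : IsCoprime (q : ℤ) (Finset.univ.gcd a) := by
        rw [Int.isCoprime_iff_gcd_eq_one, Int.gcd_comm]; exact hgcd
      exact (dvd_normalize_iff.mp (h2.dvd_of_dvd_mul_right h1))
    have h4 : |M.det| ≤ ((R.factorial * T ^ R : ℕ) : ℤ) := by
      have := Matrix.det_le (A := M) (abv := AbsoluteValue.abs) (x := (T : ℤ))
        (fun i j => hT _ (hwW i) j)
      simpa using this
    have h5 := Int.le_of_dvd (abs_pos.mpr hdet) ((dvd_abs _ _).mpr hd)
    have h6 : (q : ℤ) ≤ ((R.factorial * T ^ R : ℕ) : ℤ) := h5.trans h4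
    exact absurd (Int.ofNat_le.mp h6) (not_le.mpr hlt)
  · obtain ⟨φ, hφ0, hφ⟩ := Submodule.exists_le_ker_of_lt_top _ (lt_top_iff_ne_top.mpr htop)
    obtain ⟨s, hs⟩ := IsLocalization.exist_integer_multiples_of_finite (nonZeroDivisors ℤ)
      (fun i : Fin R => φ (Pi.single i 1))
    choose b hb using hs
    have hs0 : ((s : ℤ) : ℚ) ≠ 0 := by
      exact_mod_cast nonZeroDivisors.coe_ne_zero s
    have hb' : ∀ i, (b i : ℚ) = (s : ℤ) * φ (Pi.single i 1) := by
      intro i; simpa using hb i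
    have hφe : ∀ x : Fin R → ℚ, φ x = ∑ i, x i * φ (Pi.single i 1) := by
      intro x
      conv_lhs => rw [pi_eq_sum_univ' x]
      rw [map_sum]
      refine Finset.sum_congr rfl fun i _ => ?_
      rw [map_smul, smul_eq_mul]
    refine ⟨b, ?_, ?_⟩
    · rintro rfl
      apply hφ0
      refine LinearMap.ext fun x => ?_
      rw [hφe]
      refine Finset.sum_eq_zero fun i _ => ?_
      have := hb' i
      simp only [Pi.zero_apply, Int.cast_zero] at this
      rcases mul_eq_zero.mp this.symm with h | h
      · exact absurd h hs0
      · rw [h, mul_zero]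
    · intro w hw
      have h1 : φ (cst w) = 0 := hφ (Submodule.subset_span ⟨w, hw, rfl⟩)
      rw [hφe] at h1
      have : ((∑ i, b i * w i : ℤ) : ℚ) = (s : ℤ) * ∑ i, cst w i * φ (Pi.single i 1) := by
        push_cast
        rw [Finset.mul_sum]
        refine Finset.sum_congr rfl fun i _ => ?_
        rw [hb']; simp only [cst]; ring
      rw [h1, mul_zero] at this
      exact_mod_cast this


lemma gs_le_degree {σ : Type*} (m : σ →₀ ℕ) (i : σ) : m i ≤ m.degree := by
  exact Finsupp.le_degree i m

lemma gs_pderiv_bound {n N : ℕ} {T : ℤ} (hT : 0 ≤ T) {p : MvPolynomial (Fin n) ℤ} {L : ℕ}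
    (hL : N + 1 ≤ L) (hp : ∀ m, m.degree = N + 1 → |coeff m p| ≤ T) (i : Fin n) :
    ∀ m, m.degree = N → |coeff m (pderiv i p)| ≤ L * T := by
  have _ := hT
  intro m hm
  rw [coeff_pderiv, abs_mul, mul_comm]
  have h1 : m i ≤ N := hm ▸ gs_le_degree m i
  have h2 : |((m i : ℤ) + 1)| ≤ L := by
    rw [abs_of_nonneg (by positivity)]
    exact_mod_cast (by omega : m i + 1 ≤ L)
  refine mul_le_mul h2 (hp _ ?_) (abs_nonneg _) (by positivity)
  rw [map_add, Finsupp.degree_single, hm]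

lemma gs_iterP_bound {n L : ℕ} (k : ℕ) : ∀ (N : ℕ) (T : ℤ), 0 ≤ T → ∀ p : MvPolynomial (Fin n) ℤ,
    N + k ≤ L → (∀ m, m.degree = N + k → |coeff m p| ≤ T) → ∀ (I : Fin k → Fin n),
    ∀ m, m.degree = N → |coeff m (gsIterP k I p)| ≤ L ^ k * T := by
  induction k with
  | zero => intro N T hT p _ hp I m hm; simpa [gsIterP] using hp m hm
  | succ k ih =>
    intro N T hT p hL hp I m hm
    rw [gsIterP, pow_succ, mul_assoc]
    exact ih N (L * T) (by positivity) _ (by omega)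
      (gs_pderiv_bound hT (by omega) hp _) _ m hm

lemma gsTens_bound {n k : ℕ} {T : ℤ} (hT : 0 ≤ T) (f : MvPolynomial (Fin n) ℤ)
    (hf : ∀ m, m.degree = k + 1 → |coeff m f| ≤ T) (I : Fin k → Fin n) (j : Fin n) :
    |gsTens k f I j| ≤ ((k + 1 : ℕ) : ℤ) ^ (k + 1) * T := by
  rw [gsTens, pow_succ, mul_assoc]
  refine gs_iterP_bound (L := k + 1) k 0 _ (by positivity) _ (by omega) ?_ I 0 (by simp)
  rw [zero_add]
  exact gs_pderiv_bound hT le_rfl hf j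

lemma gsTens_congr {n k : ℕ} (f g : MvPolynomial (Fin n) ℤ)
    (hf : ∀ m, m.degree = k + 1 → coeff m f = coeff m g) (I : Fin k → Fin n) (j : Fin n) :
    gsTens k f I j = gsTens k g I j := by
  have h1 := gsTens_bound (k := k) le_rfl (f - g) (fun m hm => by simp [hf m hm]) I j
  rw [mul_zero, abs_nonpos_iff] at h1
  have h2 := gsTens_add k I g (f - g) j
  rwa [add_sub_cancel, h1, add_zero] at h2

lemma gsPsi_bound {n k B : ℕ} {T : ℕ} (f : MvPolynomial (Fin n) ℤ)
    (hf : ∀ m, m.degree = k + 1 → |coeff m f| ≤ T) (h : Fin k → Fin n → ℤ)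
    (hh : ∀ t i, |h t i| ≤ B) (j : Fin n) :
    |gsPsi k f h j| ≤ ((n ^ k * ((k + 1) ^ (k + 1) * T) * B ^ k : ℕ) : ℤ) := by
  rw [gsPsi]
  refine (Finset.abs_sum_le_sum_abs _ _).trans ?_
  calc _ ≤ ∑ I : Fin k → Fin n, (((k + 1) ^ (k + 1) * T * B ^ k : ℕ) : ℤ) := by
        refine Finset.sum_le_sum fun I _ => ?_
        rw [abs_mul, Finset.abs_prod]
        push_cast
        refine mul_le_mul ?_ ?_ (Finset.prod_nonneg fun _ _ => abs_nonneg _) (by positivity)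
        · simpa using gsTens_bound (by positivity) f hf I j
        · refine (Finset.prod_le_prod (fun _ _ => abs_nonneg _)
            (g := fun _ => (B : ℤ)) fun t _ => hh t (I t)).trans ?_
          simp
    _ = _ := by
        rw [Finset.sum_const]
        simp
        ring

lemma gsPsi_congr {n k : ℕ} (f g : MvPolynomial (Fin n) ℤ)
    (hf : ∀ m, m.degree = k + 1 → coeff m f = coeff m g) (h : Fin k → Fin n → ℤ) (j : Fin n) :
    gsPsi k f h j = gsPsi k g h j := by
  simp only [gsPsi, gsTens_congr f g hf]

open Classical in
/-- The common linear relation between the polarized gradients. -/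
lemma gs_relation {n R k q B T : ℕ} (a : Fin R → ℤ)
    (hgcd : Int.gcd (Finset.univ.gcd a) (q : ℤ) = 1)
    (g : Fin R → MvPolynomial (Fin n) ℤ)
    (hg : ∀ i m, m.degree = k + 1 → |coeff m (g i)| ≤ T)
    (hlt : R.factorial * (n ^ k * ((k + 1) ^ (k + 1) * T) * B ^ k) ^ R < q) :
    ∃ b : Fin R → ℤ, b ≠ 0 ∧
      ((Fintype.piFinset fun _ : Fin k => gsBoxB n B).filter
        fun h => ∀ j, (q : ℤ) ∣ gsPsi k (∑ i, a i • g i) h j) ⊆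
      ((Fintype.piFinset fun _ : Fin k => gsBoxB n B).filter
        fun h => ∀ j, gsPsi k (∑ i, b i • g i) h j = 0) := by
  set W : Set (Fin R → ℤ) :=
    {w | ∃ h ∈ ((Fintype.piFinset fun _ : Fin k => gsBoxB n B).filter
        fun h => ∀ j, (q : ℤ) ∣ gsPsi k (∑ i, a i • g i) h j), ∃ j,
        w = fun i => gsPsi k (g i) h j} with hW
  have hW1 : ∀ w ∈ W, ∀ i, |w i| ≤ ((n ^ k * ((k + 1) ^ (k + 1) * T) * B ^ k : ℕ) : ℤ) := by
    rintro w ⟨h, hh, j, rfl⟩ i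
    refine gsPsi_bound _ (hg i) _ (fun t i => ?_) _
    have := (Finset.mem_filter.mp hh).1
    simp only [gsBoxB, Fintype.mem_piFinset, Finset.mem_Ioo] at this
    exact abs_le.mpr ⟨(this t i).1.le, (this t i).2.le⟩
  have hW2 : ∀ w ∈ W, (q : ℤ) ∣ ∑ i, a i * w i := by
    rintro w ⟨h, hh, j, rfl⟩
    rw [← gsPsi_sum]
    exact (Finset.mem_filter.mp hh).2 j
  obtain ⟨b, hb0, hb⟩ := gs_rank a hgcd W hW1 hW2 hlt
  refine ⟨b, hb0, fun h hh => ?_⟩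
  refine Finset.mem_filter.mpr ⟨(Finset.mem_filter.mp hh).1, fun j => ?_⟩
  rw [gsPsi_sum]
  exact hb _ ⟨h, hh, j, rfl⟩


open Classical in
/-- The monomials of degree `D`. -/
def gsMons (σ : Type*) [Fintype σ] (D : ℕ) : Finset (σ →₀ ℕ) := Finset.univ.finsuppAntidiag D

lemma gs_mem_mons {σ : Type*} [Fintype σ] {D : ℕ} {m : σ →₀ ℕ} : m ∈ gsMons σ D ↔ m.degree = D := by
  classical
  simp [gsMons, Finsupp.degree_eq_sum]

/-- An ideal contains all monomials of degree `D`. -/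
def gsU {σ κ : Type*} [Field κ] (D : ℕ) (J : Ideal (MvPolynomial σ κ)) : Prop :=
  ∀ m : σ →₀ ℕ, m.degree = D → monomial m (1 : κ) ∈ J

lemma gsU.succ {σ κ : Type*} [Field κ] {D : ℕ} {J : Ideal (MvPolynomial σ κ)} (h : gsU D J) :
    gsU (D + 1) J := by
  intro m hm
  obtain ⟨i, m', rfl, hm'⟩ := gs_split hm
  have : monomial (Finsupp.single i 1 + m') (1 : κ) = X i * monomial m' 1 := by
    rw [X, monomial_mul, one_mul]
  rw [this]
  exact J.mul_mem_left _ (h m' hm')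

lemma gsU.mono {σ κ : Type*} [Field κ] {D D' : ℕ} {J : Ideal (MvPolynomial σ κ)} (h : gsU D J)
    (hD : D ≤ D') : gsU D' J := by
  induction hD with
  | refl => exact h
  | step _ ih => exact ih.succ

lemma gsU.le {σ κ : Type*} [Field κ] {D : ℕ} {J J' : Ideal (MvPolynomial σ κ)} (h : gsU D J)
    (hJ : J ≤ J') : gsU D J' := fun m hm => hJ (h m hm)

/-- An ideal closed under taking homogeneous components. -/
def gsHom {σ κ : Type*} [Field κ] (J : Ideal (MvPolynomial σ κ)) : Prop :=
  ∀ p ∈ J, ∀ i, homogeneousComponent i p ∈ J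

lemma gsHom_span {σ κ : Type*} [Field κ] (S : Set (MvPolynomial σ κ))
    (hS : ∀ p ∈ S, ∃ e, p.IsHomogeneous e) : gsHom (Ideal.span S) := by
  let _ := MvPolynomial.gradedAlgebra (σ := σ) (R := κ)
  intro p hp i
  refine homogeneousComponent_mem_of_mem ?_ hp i
  refine Ideal.homogeneous_span _ _ fun p hp => ?_
  obtain ⟨e, he⟩ := hS p hp
  exact ⟨e, he⟩

lemma gs_hom_eq_sum {σ κ : Type*} [Fintype σ] [Field κ] {e : ℕ} {p : MvPolynomial σ κ}
    (hp : p.IsHomogeneous e) : p = ∑ m : {m // m ∈ gsMons σ e}, monomial m.1 (coeff m.1 p) := by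
  classical
  rw [Finset.sum_coe_sort (gsMons σ e) (fun m => monomial m (coeff m p))]
  ext m
  rw [coeff_sum]
  simp only [coeff_monomial]
  by_cases hm : m ∈ gsMons σ e
  · rw [Finset.sum_eq_single m]
    · simp
    · intro b _ hb; rw [if_neg hb]
    · intro h; exact absurd hm h
  · rw [Finset.sum_eq_zero]
    · by_contra h
      exact hm (gs_mem_mons.mpr (by
        have := hp h
        rw [Finsupp.degree_eq_weight_one]; exact this))
    · intro b hb
      rw [if_neg]
      rintro rfl; exact hm hb

section gsUniform
variable {σ ι κ : Type*} [Fintype σ] [Fintype ι] [Field κ] (e : ι → ℕ)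

/-- Generic forms. -/
def gsGen (c : (Σ j : ι, {m // m ∈ gsMons σ (e j)}) → κ) (j : ι) : MvPolynomial σ κ :=
  ∑ m : {m // m ∈ gsMons σ (e j)}, monomial m.1 (c ⟨j, m⟩)

lemma gsGen_hom (c : (Σ j : ι, {m // m ∈ gsMons σ (e j)}) → κ) (j : ι) :
    (gsGen e c j).IsHomogeneous (e j) :=
  IsHomogeneous.sum _ _ _ fun m _ => isHomogeneous_monomial _ (gs_mem_mons.mp m.2)

lemma gsGen_openness (D : ℕ) (c₀ : (Σ j : ι, {m // m ∈ gsMons σ (e j)}) → κ)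
    (h₀ : gsU D (Ideal.span (Set.range (gsGen e c₀)))) :
    ∃ F : MvPolynomial (Σ j : ι, {m // m ∈ gsMons σ (e j)}) κ, eval c₀ F ≠ 0 ∧
      ∀ c, eval c F ≠ 0 → gsU D (Ideal.span (Set.range (gsGen e c))) := by
  classical
  have h1 : ∀ ν : {m // m ∈ gsMons σ D}, ∃ A : ι → MvPolynomial σ κ,
      ∑ j, A j * gsGen e c₀ j = monomial ν.1 1 := by
    intro ν
    have := h₀ ν.1 (gs_mem_mons.mp ν.2)
    rw [Ideal.mem_span_range_iff_exists_fun] at this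
    exact this
  choose A hA using h1
  let M : Matrix {m // m ∈ gsMons σ D} {m // m ∈ gsMons σ D}
      (MvPolynomial (Σ j : ι, {m // m ∈ gsMons σ (e j)}) κ) :=
    Matrix.of fun ν μ => ∑ j, ∑ m : {m // m ∈ gsMons σ (e j)},
      C (coeff μ.1 (A ν j * monomial m.1 1)) * X ⟨j, m⟩
  have hM : ∀ c ν μ, eval c (M ν μ) = coeff μ.1 (∑ j, A ν j * gsGen e c j) := by
    intro c ν μ
    simp only [M, Matrix.of_apply, map_sum, map_mul, eval_C, eval_X, coeff_sum, gsGen,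
      Finset.mul_sum]
    refine Finset.sum_congr rfl fun j _ => Finset.sum_congr rfl fun m _ => ?_
    have : monomial m.1 (c ⟨j, m⟩) = C (c ⟨j, m⟩) * monomial m.1 (1 : κ) := by
      rw [C_mul_monomial, mul_one]
    rw [this, mul_left_comm, coeff_C_mul, mul_comm]
  have hdet : ∀ c, eval c M.det = (M.map (eval c)).det := by
    intro c
    rw [RingHom.map_det, RingHom.mapMatrix_apply]
  refine ⟨M.det, ?_, ?_⟩
  · rw [hdet]
    have : M.map (eval c₀) = 1 := by
      ext ν μ
      rw [Matrix.map_apply, hM, hA, coeff_monomial, Matrix.one_apply]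
      simp only [Subtype.ext_iff]
    rw [this, Matrix.det_one]
    exact one_ne_zero
  · intro c hc l hl
    rw [hdet] at hc
    set N := M.map (eval c) with hN
    have hinv : N⁻¹ * N = 1 := Matrix.nonsing_inv_mul _ (isUnit_iff_ne_zero.mpr hc)
    set J := Ideal.span (Set.range (gsGen e c)) with hJ
    have hJh : gsHom J := gsHom_span _ (by rintro p ⟨j, rfl⟩; exact ⟨_, gsGen_hom e c j⟩)
    have hH : ∀ ν, ∑ μ : {m // m ∈ gsMons σ D}, monomial μ.1 (N ν μ) ∈ J := by
      intro ν
      have h2 : homogeneousComponent D (∑ j, A ν j * gsGen e c j) ∈ J :=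
        hJh _ (Ideal.sum_mem _ fun j _ => J.mul_mem_left _ (Ideal.subset_span ⟨j, rfl⟩)) D
      rw [gs_hom_eq_sum (homogeneousComponent_isHomogeneous D _)] at h2
      convert h2 using 1
      refine Finset.sum_congr rfl fun μ _ => ?_
      rw [hN, Matrix.map_apply, hM, coeff_homogeneousComponent, if_pos (gs_mem_mons.mp μ.2)]
    let l' : {m // m ∈ gsMons σ D} := ⟨l, gs_mem_mons.mpr hl⟩
    have h3 : monomial l (1 : κ) = ∑ ν, C (N⁻¹ l' ν) *
        ∑ μ : {m // m ∈ gsMons σ D}, monomial μ.1 (N ν μ) := by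
      simp only [Finset.mul_sum, C_mul_monomial]
      rw [Finset.sum_comm]
      have h4 : ∀ μ : {m // m ∈ gsMons σ D}, ∑ ν, monomial μ.1 (N⁻¹ l' ν * N ν μ) =
          monomial μ.1 ((1 : Matrix _ _ κ) l' μ) := by
        intro μ
        rw [← hinv, Matrix.mul_apply, map_sum]
      simp only [h4]
      rw [Finset.sum_eq_single l']
      · simp [l']
      · intro b _ hb; rw [Matrix.one_apply_ne hb.symm, map_zero]
      · simp
    rw [h3]
    exact Ideal.sum_mem _ fun ν _ => J.mul_mem_left _ (hH ν)

/-- Uniformity of the exponent. -/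
lemma gs_uniform : ∃ D₀ : ℕ, ∀ G : ι → MvPolynomial σ κ, (∀ j, (G j).IsHomogeneous (e j)) →
    (∃ D, gsU D (Ideal.span (Set.range G))) → gsU D₀ (Ideal.span (Set.range G)) := by
  classical
  let P := (Σ j : ι, {m // m ∈ gsMons σ (e j)})
  let a : ℕ → Ideal (MvPolynomial P κ) := fun D =>
    { carrier := {F | ∀ c, ¬ gsU D (Ideal.span (Set.range (gsGen e c))) → eval c F = 0}
      add_mem' := fun {F G} hF hG c hc => by rw [map_add, hF c hc, hG c hc, add_zero]
      zero_mem' := fun c _ => map_zero _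
      smul_mem' := fun F G hG c hc => by rw [smul_eq_mul, map_mul, hG c hc, mul_zero] }
  have ha : Monotone a := by
    intro D D' hD F hF c hc
    exact hF c fun h => hc (h.mono hD)
  obtain ⟨D₀, hD₀⟩ := (monotone_stabilizes_iff_noetherian
    (R := MvPolynomial P κ) (M := MvPolynomial P κ)).mpr inferInstance ⟨a, ha⟩
  refine ⟨D₀, fun G hG ⟨D, hD⟩ => ?_⟩
  let c₀ : P → κ := fun x => coeff x.2.1 (G x.1)
  have hc₀ : gsGen e c₀ = G := by
    funext j
    exact (gs_hom_eq_sum (hG j)).symm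
  rw [← hc₀] at hD ⊢
  by_contra hcon
  obtain ⟨F, hF1, hF2⟩ := gsGen_openness e (max D D₀) c₀ (hD.mono (le_max_left _ _))
  have hFm : F ∈ a (max D D₀) := fun c hc => by
    by_contra h; exact hc (hF2 c h)
  have : a D₀ = a (max D D₀) := hD₀ _ (le_max_right _ _)
  rw [← this] at hFm
  exact hF1 (hFm c₀ hcon)

end gsUniform


/-- The linear form with coefficient vector `v`. -/
def gsLin {σ κ : Type*} [Fintype σ] [Field κ] : (σ → κ) →ₗ[κ] MvPolynomial σ κ where
  toFun v := ∑ i, C (v i) * X i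
  map_add' u v := by simp [add_mul, Finset.sum_add_distrib]
  map_smul' a v := by
    simp only [Pi.smul_apply, smul_eq_mul, map_mul, RingHom.id_apply, smul_eq_C_mul,
      Finset.mul_sum, mul_assoc]

lemma gsLin_apply {σ κ : Type*} [Fintype σ] [Field κ] (v : σ → κ) :
    gsLin v = ∑ i, C (v i) * X i := rfl

lemma gsLin_hom {σ κ : Type*} [Fintype σ] [Field κ] (v : σ → κ) : (gsLin v).IsHomogeneous 1 := by
  rw [gsLin_apply]
  refine IsHomogeneous.sum _ _ _ fun i _ => ?_
  simpa using (isHomogeneous_C σ (v i)).mul (isHomogeneous_X κ i)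

lemma gsLin_single {σ κ : Type*} [Fintype σ] [DecidableEq σ] [Field κ] (i : σ) :
    gsLin (Pi.single i (1 : κ)) = X i := by
  rw [gsLin_apply, Finset.sum_eq_single i]
  · simp
  · intro b _ hb; simp [hb]
  · simp

lemma gsHom_sup {σ κ : Type*} [Field κ] {J K : Ideal (MvPolynomial σ κ)} (hJ : gsHom J)
    (hK : gsHom K) : gsHom (J ⊔ K) := by
  intro p hp i
  obtain ⟨a, ha, b, hb, rfl⟩ := Submodule.mem_sup.mp hp
  rw [map_add]
  exact Submodule.add_mem_sup (hJ a ha i) (hK b hb i)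

/-- A prime containing all variables is maximal. -/
lemma gs_prime_max {σ κ : Type*} [Field κ] (p q : Ideal (MvPolynomial σ κ))
    (hX : ∀ i, X i ∈ p) (hpq : p < q) : q = ⊤ := by
  have h1 : ∀ f : MvPolynomial σ κ, f - C (coeff 0 f) ∈ p := by
    intro f
    induction f using MvPolynomial.induction_on with
    | C a => simp
    | add f g hf hg =>
      have := p.add_mem hf hg
      rw [coeff_add, map_add]
      convert this using 1
      ring
    | mul_X f i _ =>
      have : coeff 0 (f * X i) = 0 := by
        classical
        rw [coeff_mul_X']; simp
      rw [this, map_zero, sub_zero]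
      exact p.mul_mem_left _ (hX i)
  obtain ⟨f, hfq, hfp⟩ := SetLike.exists_of_lt hpq
  have h2 : C (coeff 0 f) ∈ q := by
    have := q.sub_mem hfq (hpq.le (h1 f))
    simpa using this
  have h3 : coeff 0 f ≠ 0 := by
    intro h; apply hfp; have := h1 f; rwa [h, map_zero, sub_zero] at this
  refine Ideal.eq_top_of_isUnit_mem _ h2 ?_
  exact (isUnit_iff_ne_zero.mpr h3).map C

lemma gs_choose_lin {σ κ : Type*} [Fintype σ] [Field κ] [Infinite κ]
    (J : Ideal (MvPolynomial σ κ)) :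
    ∃ v : σ → κ, ∀ p ∈ J.minimalPrimes, gsLin v ∈ p → ∀ i, X i ∈ p := by
  classical
  have hfin := J.finite_minimalPrimes_of_isNoetherianRing
  let S : Finset (Subspace κ (σ → κ)) :=
    ((hfin.toFinset.image fun p => (p.restrictScalars κ).comap gsLin).filter fun W => W ≠ ⊤)
  have h := Subspace.biUnion_ne_univ_of_top_notMem (s := S) (by simp [S])
  obtain ⟨v, hv⟩ := (Set.ne_univ_iff_exists_notMem _).mp h
  refine ⟨v, fun p hp hvp => ?_⟩
  simp only [Set.mem_iUnion, not_exists] at hv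
  have htop : (p.restrictScalars κ).comap gsLin = ⊤ := by
    by_contra hne
    refine hv ((p.restrictScalars κ).comap gsLin) ?_ hvp
    simp only [S, Finset.mem_filter, Finset.mem_image, Set.Finite.mem_toFinset]
    exact ⟨⟨p, hp, rfl⟩, hne⟩
  intro i
  have : Pi.single i (1 : κ) ∈ (p.restrictScalars κ).comap gsLin := by rw [htop]; trivial
  have h2 : gsLin (Pi.single i (1 : κ)) ∈ p := this
  rwa [gsLin_single] at h2

lemma gs_dim_drop {σ κ : Type*} [Fintype σ] [Field κ] [Infinite κ]
    (J : Ideal (MvPolynomial σ κ)) (s : ℕ)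
    (hs : ringKrullDim (MvPolynomial σ κ ⧸ J) ≤ ((s + 1 : ℕ) : WithBot ℕ∞)) :
    ∃ v : σ → κ, ringKrullDim (MvPolynomial σ κ ⧸ (J ⊔ Ideal.span {gsLin v})) ≤ (s : WithBot ℕ∞) := by
  obtain ⟨v, hv⟩ := gs_choose_lin J
  refine ⟨v, ?_⟩
  rw [ringKrullDim_quotient] at hs ⊢
  refine iSup_le fun p => ?_
  let ψ : (PrimeSpectrum.zeroLocus (R := MvPolynomial σ κ) (J ⊔ Ideal.span {gsLin v} : Ideal _)) →
      (PrimeSpectrum.zeroLocus (R := MvPolynomial σ κ) J) :=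
    fun x => ⟨x.1, fun y hy => x.2 (Submodule.mem_sup_left hy)⟩
  have hψ : StrictMono ψ := fun x y hxy => hxy
  let p' := p.map ψ hψ
  by_cases hc : ∃ y : PrimeSpectrum.zeroLocus (R := MvPolynomial σ κ) J, y < p'.head
  · obtain ⟨y, hy⟩ := hc
    have h1 := (Order.LTSeries.length_le_krullDim (p'.cons y hy)).trans hs
    have h2 : p.length + 1 ≤ s + 1 := by
      have : (p'.cons y hy).length = p.length + 1 := by simp [p']
      rw [this] at h1
      exact_mod_cast h1
    exact_mod_cast (by omega : p.length ≤ s)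
  · have hmin : p.head.1.asIdeal ∈ J.minimalPrimes := by
      refine ⟨⟨p.head.1.isPrime, (ψ p.head).2⟩, fun Q hQ hle => ?_⟩
      by_contra hcon
      apply hc
      refine ⟨⟨⟨Q, hQ.1⟩, hQ.2⟩, ?_⟩
      exact lt_of_le_not_ge hle hcon
    have hX := hv _ hmin (p.head.2 (Submodule.mem_sup_right (Ideal.subset_span rfl)))
    have h0 : p.length = 0 := by
      by_contra hne
      have hlt : p.head < p.toFun ⟨1, by omega⟩ := p.strictMono (by
        rw [Fin.lt_def]; simp)
      have := gs_prime_max p.head.1.asIdeal (p.toFun ⟨1, by omega⟩).1.asIdeal hX hlt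
      exact (p.toFun ⟨1, by omega⟩).1.isPrime.ne_top this
    rw [h0]
    exact_mod_cast Nat.zero_le s

lemma gs_hom_comp_aeval {σ κ : Type*} [Field κ] (i : σ) (p : Polynomial κ) (N : ℕ) :
    homogeneousComponent N (Polynomial.aeval (X i : MvPolynomial σ κ) p) =
      C (p.coeff N) * X i ^ N := by
  classical
  induction p using Polynomial.induction_on' with
  | add p q hp hq => rw [map_add, map_add, hp, hq, Polynomial.coeff_add, map_add, add_mul]
  | monomial k a =>
    rw [Polynomial.aeval_monomial, Polynomial.coeff_monomial]
    have h : (C a * X i ^ k : MvPolynomial σ κ).IsHomogeneous k := by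
      simpa using (isHomogeneous_C σ a).mul (isHomogeneous_X_pow i k)
    rw [show algebraMap κ (MvPolynomial σ κ) a = C a from rfl, homogeneousComponent_of_mem h]
    split_ifs with h1 h2 h2
    · rw [h2]
    · exact absurd h1.symm h2
    · exact absurd h2.symm h1
    · simp

lemma gs_base {σ κ : Type*} [Fintype σ] [Field κ] (J : Ideal (MvPolynomial σ κ)) (hJ : gsHom J)
    (hs : ringKrullDim (MvPolynomial σ κ ⧸ J) ≤ 0) : ∃ D, gsU D J := by
  have hK : Ring.KrullDimLE 0 (MvPolynomial σ κ ⧸ J) := by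
    rw [Ring.krullDimLE_iff]; exact hs
  have hfin : Module.Finite κ (MvPolynomial σ κ ⧸ J) := (Module.finite_iff_krullDimLE_zero κ _).mpr hK
  have h1 : ∀ i : σ, ∃ N, (X i : MvPolynomial σ κ) ^ N ∈ J := by
    intro i
    obtain ⟨p, hp, hp0⟩ := Algebra.IsIntegral.isIntegral (R := κ) (Ideal.Quotient.mk J (X i))
    refine ⟨p.natDegree, ?_⟩
    have h2 : Polynomial.aeval (X i : MvPolynomial σ κ) p ∈ J := by
      rw [← Ideal.Quotient.eq_zero_iff_mem, ← Ideal.Quotient.mkₐ_eq_mk κ, ← Polynomial.aeval_algHom_apply]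
      exact hp0
    have h3 := hJ _ h2 p.natDegree
    rwa [gs_hom_comp_aeval, hp.coeff_natDegree, map_one, one_mul] at h3
  choose N hN using h1
  refine ⟨∑ i, N i + 1, fun m hm => ?_⟩
  have h4 : ∃ i, N i ≤ m i := by
    by_contra hcon
    push Not at hcon
    rw [Finsupp.degree_eq_sum] at hm
    have := Finset.sum_le_sum fun i (_ : i ∈ Finset.univ) => (hcon i).le
    omega
  obtain ⟨i, hi⟩ := h4
  have h5 : monomial m (1 : κ) = monomial (m - Finsupp.single i (N i)) 1 * X i ^ N i := by
    rw [X_pow_eq_monomial, monomial_mul, one_mul, tsub_add_cancel_of_le]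
    rwa [Finsupp.single_le_iff]
  rw [h5]
  exact J.mul_mem_left _ (hN i)

lemma gs_sections {σ κ : Type*} [Fintype σ] [Field κ] [Infinite κ] (s : ℕ) :
    ∀ J : Ideal (MvPolynomial σ κ), gsHom J →
    ringKrullDim (MvPolynomial σ κ ⧸ J) ≤ (s : WithBot ℕ∞) →
    ∃ v : Fin s → σ → κ, ∃ D, gsU D (J ⊔ Ideal.span (Set.range fun l => gsLin (v l))) := by
  induction s with
  | zero =>
    intro J hJ hs
    obtain ⟨D, hD⟩ := gs_base J hJ (by simpa using hs)
    exact ⟨Fin.elim0, D, hD.le le_sup_left⟩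
  | succ s ih =>
    intro J hJ hs
    obtain ⟨v, hv⟩ := gs_dim_drop J s hs
    obtain ⟨w, D, hD⟩ := ih (J ⊔ Ideal.span {gsLin v}) (gsHom_sup hJ (gsHom_span _ (by
      rintro p rfl; exact ⟨1, gsLin_hom v⟩))) hv
    refine ⟨Fin.cons v w, D, hD.le ?_⟩
    refine sup_le (sup_le le_sup_left ?_) ?_
    · refine le_trans ?_ le_sup_right
      rw [Ideal.span_le]
      rintro p rfl
      exact Ideal.subset_span ⟨0, by simp⟩
    · refine le_trans ?_ le_sup_right
      rw [Ideal.span_le]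
      rintro p ⟨l, rfl⟩
      exact Ideal.subset_span ⟨l.succ, by simp⟩


open Classical in
/-- The monomials of degree less than `D`. -/
def gsMonsLt (σ : Type*) [Fintype σ] (D : ℕ) : Finset (σ →₀ ℕ) := (Finset.range D).biUnion (gsMons σ)

lemma gs_mem_monsLt {σ : Type*} [Fintype σ] {D : ℕ} {m : σ →₀ ℕ} :
    m ∈ gsMonsLt σ D ↔ m.degree < D := by
  classical
  simp [gsMonsLt, gs_mem_mons]

section gsPolyMethod
variable {σ ι κ : Type*} [Fintype σ] [Fintype ι] [Field κ]

/-- The span of the `x^u M^v` with `|u| < D`, `v ≤ T`. -/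
def gsW (M : ι → MvPolynomial σ κ) (D T : ℕ) : Submodule κ (MvPolynomial σ κ) :=
  Submodule.span κ {p | ∃ u : σ →₀ ℕ, u.degree < D ∧ ∃ v : ι → ℕ, (∀ l, v l ≤ T) ∧
    p = monomial u 1 * ∏ l, M l ^ v l}

lemma gsW_mono (M : ι → MvPolynomial σ κ) (D : ℕ) {T T' : ℕ} (h : T ≤ T') :
    gsW M D T ≤ gsW M D T' := by
  refine Submodule.span_mono ?_
  rintro p ⟨u, hu, v, hv, rfl⟩
  exact ⟨u, hu, v, fun l => (hv l).trans h, rfl⟩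

lemma gsW_mul (M : ι → MvPolynomial σ κ) (D : ℕ) {T : ℕ} (l : ι) {p : MvPolynomial σ κ}
    (hp : p ∈ gsW M D T) : p * M l ∈ gsW M D (T + 1) := by
  classical
  have h : (gsW M D T) ≤ (gsW M D (T + 1)).comap (LinearMap.mulRight κ (M l)) := by
    rw [gsW, Submodule.span_le]
    rintro p ⟨u, hu, v, hv, rfl⟩
    refine Submodule.subset_span ⟨u, hu, v + Pi.single l 1, fun l' => ?_, ?_⟩
    · by_cases h : l' = l
      · subst h; simpa using hv l'
      · simpa [h] using (hv l').trans (Nat.le_succ T)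
    · rw [LinearMap.mulRight_apply, mul_assoc]
      congr 1
      simp only [Pi.add_apply, pow_add, Finset.prod_mul_distrib]
      congr 1
      rw [Finset.prod_eq_single l]
      · simp
      · intro b _ hb; simp [hb]
      · simp
  exact h hp

lemma gs_hom_comp_mul {e T : ℕ} {M p : MvPolynomial σ κ} (hM : M.IsHomogeneous e) :
    homogeneousComponent (T + e) (p * M) = homogeneousComponent T p * M := by
  classical
  conv_lhs => rw [← sum_homogeneousComponent p, Finset.sum_mul, map_sum]
  have h : ∀ i, homogeneousComponent (T + e) (homogeneousComponent i p * M) =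
      if i = T then homogeneousComponent i p * M else 0 := by
    intro i
    rw [homogeneousComponent_of_mem ((homogeneousComponent_isHomogeneous i p).mul hM)]
    by_cases h : i = T
    · simp [h]
    · rw [if_neg h, if_neg (by omega)]
  simp only [h]
  rw [Finset.sum_ite_eq']
  split_ifs with h1
  · rfl
  · rw [homogeneousComponent_eq_zero _ _ (by simpa using h1), zero_mul]

lemma gs_hom_comp_mul_zero {M p : MvPolynomial σ κ} (hM : M.IsHomogeneous 1) :
    homogeneousComponent 0 (p * M) = 0 := by
  rw [homogeneousComponent_zero]
  have h1 : coeff 0 M = 0 := by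
    by_contra h
    have := hM h
    simp at this
  have : coeff 0 (p * M) = coeff 0 p * coeff 0 M := by
    simpa [constantCoeff_eq] using map_mul (constantCoeff (R := κ) (σ := σ)) p M
  rw [this, h1, mul_zero, map_zero]

lemma gs_reduce (I : Ideal (MvPolynomial σ κ)) (hI : gsHom I) (M : ι → MvPolynomial σ κ)
    (hM : ∀ l, (M l).IsHomogeneous 1) (D : ℕ) (hD : gsU D (I ⊔ Ideal.span (Set.range M))) (T : ℕ) :
    ∀ p : MvPolynomial σ κ, p.IsHomogeneous T → p ∈ I.restrictScalars κ ⊔ gsW M D T := by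
  induction T using Nat.strong_induction_on with
  | _ T ih =>
    have hmon : ∀ m : σ →₀ ℕ, m.degree = T → monomial m (1 : κ) ∈ I.restrictScalars κ ⊔ gsW M D T := by
      intro m hm
      by_cases hTD : T < D
      · refine Submodule.mem_sup_right (Submodule.subset_span ⟨m, hm ▸ hTD, 0, fun _ => Nat.zero_le _, ?_⟩)
        simp
      · have h1 := hD.mono (not_lt.mp hTD) m hm
        obtain ⟨a, ha, b, hb, hab⟩ := Submodule.mem_sup.mp h1
        rw [Ideal.mem_span_range_iff_exists_fun] at hb
        obtain ⟨c, rfl⟩ := hb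
        have h2 : monomial m (1 : κ) = homogeneousComponent T a +
            ∑ l, homogeneousComponent T (c l * M l) := by
          have h3 := congrArg (homogeneousComponent T) hab
          rw [homogeneousComponent_of_mem (isHomogeneous_monomial _ hm), if_pos rfl, map_add,
            map_sum] at h3
          exact h3.symm
        rw [h2]
        refine Submodule.add_mem _ (Submodule.mem_sup_left (hI a ha T)) (Submodule.sum_mem _ fun l _ => ?_)
        rcases T with _ | T
        · rw [gs_hom_comp_mul_zero (hM l)]; exact Submodule.zero_mem _
        · rw [gs_hom_comp_mul (hM l)]
          obtain ⟨x, hx, y, hy, hxy⟩ := Submodule.mem_sup.mp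
            (ih T (Nat.lt_succ_self T) _ (homogeneousComponent_isHomogeneous T (c l)))
          rw [← hxy, add_mul]
          exact Submodule.add_mem_sup (I.mul_mem_right _ hx) (gsW_mul M D l hy)
    intro p hp
    rw [gs_hom_eq_sum hp]
    refine Submodule.sum_mem _ fun m _ => ?_
    have : monomial m.1 (coeff m.1 p) = coeff m.1 p • monomial m.1 (1 : κ) := by
      rw [smul_monomial, smul_eq_mul, mul_one]
    rw [this]
    exact Submodule.smul_mem _ _ (hmon m.1 (gs_mem_mons.mp m.2))

lemma gs_reduce_le (I : Ideal (MvPolynomial σ κ)) (hI : gsHom I) (M : ι → MvPolynomial σ κ)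
    (hM : ∀ l, (M l).IsHomogeneous 1) (D : ℕ) (hD : gsU D (I ⊔ Ideal.span (Set.range M))) (T : ℕ)
    (p : MvPolynomial σ κ) (hp : p.totalDegree ≤ T) : p ∈ I.restrictScalars κ ⊔ gsW M D T := by
  rw [← sum_homogeneousComponent p]
  refine Submodule.sum_mem _ fun i hi => ?_
  have h1 := gs_reduce I hI M hM D hD i _ (homogeneousComponent_isHomogeneous i p)
  refine sup_le_sup le_rfl (gsW_mono M D ?_) h1
  rw [Finset.mem_range] at hi
  omega

/-- The polynomial method: counting zeros of a homogeneous ideal in a grid. -/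
lemma gs_polymethod (I : Ideal (MvPolynomial σ κ)) (hI : gsHom I) (M : ι → MvPolynomial σ κ)
    (hM : ∀ l, (M l).IsHomogeneous 1) (D : ℕ) (hD : gsU D (I ⊔ Ideal.span (Set.range M)))
    (A : Finset κ) (S : Finset (σ → κ)) (hSA : ∀ x ∈ S, ∀ i, x i ∈ A)
    (hSI : ∀ x ∈ S, ∀ p ∈ I, eval x p = 0) :
    S.card ≤ (gsMonsLt σ D).card * (Fintype.card σ * A.card + 1) ^ Fintype.card ι := by
  classical
  set T := Fintype.card σ * A.card with hT
  let ev : MvPolynomial σ κ →ₗ[κ] (S → κ) := LinearMap.pi fun x => (aeval x.1).toLinearMap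
  have hev : ∀ p x, ev p x = eval x.1 p := fun p x => by
    simp [ev, aeval_eq_eval]
  let fam : {m // m ∈ gsMonsLt σ D} × (ι → Fin (T + 1)) → (S → κ) :=
    fun uv => ev (monomial uv.1.1 1 * ∏ l, M l ^ (uv.2 l : ℕ))
  have hW : ∀ p ∈ gsW M D T, ev p ∈ Submodule.span κ (Set.range fam) := by
    intro p hp
    have h : gsW M D T ≤ (Submodule.span κ (Set.range fam)).comap ev := by
      rw [gsW, Submodule.span_le]
      rintro p ⟨u, hu, v, hv, rfl⟩
      exact Submodule.subset_span
        ⟨(⟨u, gs_mem_monsLt.mpr hu⟩, fun l => ⟨v l, Nat.lt_succ_of_le (hv l)⟩), rfl⟩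
    exact h hp
  have htop : Submodule.span κ (Set.range fam) = ⊤ := by
    rw [eq_top_iff, ← (Pi.basisFun κ S).span_eq, Submodule.span_le]
    rintro _ ⟨x, rfl⟩
    let E : MvPolynomial σ κ := ∏ i, ∏ α ∈ A.erase (x.1 i), (X i - C α)
    have hE1 : E.totalDegree ≤ T := by
      refine (totalDegree_finset_prod _ _).trans ?_
      rw [hT, ← smul_eq_mul, ← Finset.card_univ, ← Finset.sum_const]
      refine Finset.sum_le_sum fun i _ => ?_
      refine (totalDegree_finset_prod _ _).trans ?_
      calc _ ≤ ∑ α ∈ A.erase (x.1 i), 1 := by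
            refine Finset.sum_le_sum fun α _ => ?_
            refine (totalDegree_sub _ _).trans ?_
            simp
        _ ≤ A.card := by
            rw [Finset.sum_const, smul_eq_mul, mul_one]
            exact Finset.card_le_card (Finset.erase_subset _ _)
    have hE2 : eval x.1 E ≠ 0 := by
      simp only [E, map_prod, map_sub, eval_X, eval_C]
      refine Finset.prod_ne_zero_iff.mpr fun i _ => Finset.prod_ne_zero_iff.mpr fun α hα => ?_
      exact sub_ne_zero.mpr (Finset.ne_of_mem_erase hα).symm
    have hE3 : ∀ y : S, y ≠ x → eval y.1 E = 0 := by
      intro y hy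
      obtain ⟨i, hi⟩ := Function.ne_iff.mp (fun h => hy (Subtype.ext h) : y.1 ≠ x.1)
      simp only [E, map_prod, map_sub, eval_X, eval_C]
      refine Finset.prod_eq_zero (Finset.mem_univ i) (Finset.prod_eq_zero
        (Finset.mem_erase.mpr ⟨hi, hSA y.1 y.2 i⟩) (sub_self _))
    obtain ⟨a, ha, b, hb, hab⟩ := Submodule.mem_sup.mp (gs_reduce_le I hI M hM D hD T E hE1)
    have h1 : ev E = ev b := by
      rw [← hab, map_add]
      have : ev a = 0 := by
        funext y
        rw [hev]; exact hSI y.1 y.2 a ha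
      rw [this, zero_add]
    have h2 : Pi.basisFun κ S x = (eval x.1 E)⁻¹ • ev b := by
      rw [← h1]
      funext y
      rw [Pi.basisFun_apply, Pi.smul_apply, hev, smul_eq_mul]
      by_cases hy : y = x
      · subst hy; simp [inv_mul_cancel₀ hE2]
      · rw [hE3 y hy, mul_zero, Pi.single_eq_of_ne hy]
    rw [h2]
    exact Submodule.smul_mem _ _ (hW b hb)
  have h3 := finrank_range_le_card (R := κ) fam
  rw [Set.finrank, htop, finrank_top, Module.finrank_fintype_fun_eq_card, Fintype.card_coe] at h3
  simpa using h3

end gsPolyMethod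


lemma gs_euler {n : ℕ} {A : Type*} [CommRing A] (k : ℕ) : ∀ (p : MvPolynomial (Fin n) A),
    p.IsHomogeneous k →
    ∑ I : Fin k → Fin n, C (coeff 0 (gsIterP k I p)) * ∏ t, X (I t) = (k.factorial : MvPolynomial (Fin n) A) * p := by
  induction k with
  | zero =>
    intro p hp
    have : p = C (coeff 0 p) := by
      apply totalDegree_eq_zero_iff_eq_C.mp
      exact Nat.le_zero.mp hp.totalDegree_le
    simp only [gsIterP, Finset.univ_unique, Finset.prod_of_isEmpty, mul_one, Finset.sum_const,
      Finset.card_singleton, one_smul, Nat.factorial_zero, Nat.cast_one, one_mul]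
    exact this.symm
  | succ k ih =>
    intro p hp
    rw [gs_sum_cons (M := MvPolynomial (Fin n) A)]
    have h1 : ∀ i : Fin n, ∑ I : Fin k → Fin n, C (coeff 0 (gsIterP (k+1) (Fin.cons i I : Fin (k+1) → Fin n) p)) *
        ∏ t, X ((Fin.cons i I : Fin (k+1) → Fin n) t) = (k.factorial : MvPolynomial (Fin n) A) * (X i * pderiv i p) := by
      intro i
      have hp' : (pderiv i p).IsHomogeneous k := by simpa using hp.pderiv (i := i)
      have := ih _ hp'
      calc _ = X i * ∑ I : Fin k → Fin n, C (coeff 0 (gsIterP k I (pderiv i p))) * ∏ t, X (I t) := by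
            rw [Finset.mul_sum]
            refine Finset.sum_congr rfl fun I _ => ?_
            rw [Fin.prod_univ_succ]
            simp only [gsIterP, Fin.cons_zero, Fin.cons_succ, Fin.tail_cons]
            ring
        _ = _ := by rw [this]; ring
    simp_rw [h1]
    rw [← Finset.mul_sum, hp.sum_X_mul_pderiv, Nat.factorial_succ]
    simp only [nsmul_eq_mul]
    push_cast
    ring

/-- The polarized gradient with polynomial variables. -/
def gsPoly {n : ℕ} {κ : Type*} [Field κ] (k : ℕ) (g : MvPolynomial (Fin n) κ) (j : Fin n) :
    MvPolynomial (Fin k × Fin n) κ := gsPsi k g (fun t i => X (t, i)) j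

lemma gsPoly_eq {n : ℕ} {κ : Type*} [Field κ] (k : ℕ) (g : MvPolynomial (Fin n) κ) (j : Fin n) :
    gsPoly k g j = ∑ I : Fin k → Fin n, C (gsTens k g I j) * ∏ t, X (t, I t) := rfl

lemma gsPoly_hom {n : ℕ} {κ : Type*} [Field κ] (k : ℕ) (g : MvPolynomial (Fin n) κ) (j : Fin n) :
    (gsPoly k g j).IsHomogeneous k := by
  rw [gsPoly_eq]
  refine IsHomogeneous.sum _ _ _ fun I _ => ?_
  have := (isHomogeneous_C (Fin k × Fin n) (gsTens k g I j)).mul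
    (IsHomogeneous.prod Finset.univ (fun t => (X (t, I t) : MvPolynomial (Fin k × Fin n) κ)) (fun _ => 1)
      (fun t _ => isHomogeneous_X κ (t, I t)))
  simpa using this

lemma gsPoly_eval {n : ℕ} {κ : Type*} [Field κ] (k : ℕ) (g : MvPolynomial (Fin n) κ) (j : Fin n)
    (h : Fin k × Fin n → κ) : eval h (gsPoly k g j) = gsPsi k g (fun t i => h (t, i)) j := by
  rw [gsPoly_eq, gsPsi]
  simp

lemma gsPoly_rename {n : ℕ} {κ : Type*} [Field κ] (k : ℕ) (g : MvPolynomial (Fin n) κ)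
    (hg : g.IsHomogeneous (k + 1)) (j : Fin n) :
    rename Prod.snd (gsPoly k g j) = (k.factorial : MvPolynomial (Fin n) κ) * pderiv j g := by
  have hp' : (pderiv j g).IsHomogeneous k := by simpa using hg.pderiv (i := j)
  rw [← gs_euler k _ hp', gsPoly_eq]
  simp [gsTens]

/-- The linear forms cutting out the diagonal and the sections of it. -/
def gsCut {n s k' : ℕ} {κ : Type*} [Field κ] (v : Fin s → Fin n → κ) :
    (Fin k' × Fin n) ⊕ Fin s → MvPolynomial (Fin (k' + 1) × Fin n) κ :=
  Sum.elim (fun p => X (p.1.succ, p.2) - X (0, p.2)) (fun l => rename (fun i => (0, i)) (gsLin (v l)))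

lemma gsCut_hom {n s k' : ℕ} {κ : Type*} [Field κ] (v : Fin s → Fin n → κ) (l) :
    (gsCut (k' := k') v l).IsHomogeneous 1 := by
  rcases l with p | l
  · exact (isHomogeneous_X κ _).sub (isHomogeneous_X κ _)
  · exact (gsLin_hom (v l)).rename_isHomogeneous

lemma gs_diag {n s k' D : ℕ} {κ : Type*} [Field κ] [CharZero κ] (g : MvPolynomial (Fin n) κ)
    (hg : g.IsHomogeneous (k' + 2)) (v : Fin s → Fin n → κ)
    (hD : gsU D (Ideal.span (Set.range fun j => pderiv j g) ⊔ Ideal.span (Set.range fun l => gsLin (v l)))) :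
    gsU D (Ideal.span (Set.range (gsPoly (k'+1) g)) ⊔ Ideal.span (Set.range (gsCut (k' := k') v))) := by
  set Q := Ideal.span (Set.range (gsPoly (k'+1) g)) ⊔ Ideal.span (Set.range (gsCut (k' := k') v)) with hQ
  let π : MvPolynomial (Fin (k'+1) × Fin n) κ →ₐ[κ] _ := Ideal.Quotient.mkₐ κ Q
  let ρ : MvPolynomial (Fin n) κ →ₐ[κ] MvPolynomial (Fin (k'+1) × Fin n) κ := rename (fun i => (0, i))
  let γ : MvPolynomial (Fin (k'+1) × Fin n) κ →ₐ[κ] MvPolynomial (Fin n) κ := rename Prod.snd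
  have hπ0 : ∀ p, π p = 0 ↔ p ∈ Q := fun p => Ideal.Quotient.eq_zero_iff_mem
  have hX : ∀ t i, π (X (t, i)) = π (X (0, i)) := by
    intro t i
    refine Fin.cases rfl (fun t => ?_) t
    rw [← sub_eq_zero, ← map_sub, hπ0]
    exact (le_sup_right : _ ≤ Q) (Ideal.subset_span ⟨Sum.inl (t, i), rfl⟩)
  have hcomp : π = (π.comp ρ).comp γ := by
    apply algHom_ext
    rintro ⟨t, i⟩
    rw [hX]
    simp [ρ, γ]
  have hcomp' : ∀ p, π p = π (ρ (γ p)) := fun p => by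
    conv_lhs => rw [hcomp]
    rfl
  have hk : ∀ p ∈ Ideal.span (Set.range fun j => pderiv j g) ⊔ Ideal.span (Set.range fun l => gsLin (v l)),
      π (ρ p) = 0 := by
    have : Ideal.span (Set.range fun j => pderiv j g) ⊔ Ideal.span (Set.range fun l => gsLin (v l))
        ≤ RingHom.ker (π.comp ρ) := by
      refine sup_le (Ideal.span_le.mpr ?_) (Ideal.span_le.mpr ?_)
      · rintro _ ⟨j, rfl⟩
        have h1 : π (ρ (γ (gsPoly (k'+1) g j))) = 0 := by
          rw [← hcomp', hπ0]
          exact (le_sup_left : _ ≤ Q) (Ideal.subset_span ⟨j, rfl⟩)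
        have h2 : γ (gsPoly (k'+1) g j) = ((k'+1).factorial : κ) • pderiv j g := by
          rw [show γ (gsPoly (k'+1) g j) = _ from gsPoly_rename (k'+1) g hg j, smul_eq_C_mul]
          simp
        rw [h2, map_smul, map_smul] at h1
        have h3 : ((k'+1).factorial : κ) ≠ 0 := by exact_mod_cast Nat.factorial_ne_zero _
        exact (smul_eq_zero_iff_right h3).mp h1
      · rintro _ ⟨l, rfl⟩
        change π (ρ _) = 0
        rw [hπ0]
        exact (le_sup_right : _ ≤ Q) (Ideal.subset_span ⟨Sum.inr l, rfl⟩)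
    exact fun p hp => this hp
  intro m hm
  rw [← hπ0, hcomp']
  apply hk
  have : γ (monomial m 1) = monomial (m.mapDomain Prod.snd) 1 := rename_monomial _ _ _
  rw [this]
  apply hD
  rw [← hm]
  exact Finsupp.degree_mapDomain _ _


open Classical in
lemma gs_count (n k' s : ℕ) : ∃ c : ℕ, ∀ g : MvPolynomial (Fin n) ℤ, g.IsHomogeneous (k' + 2) →
    ringKrullDim (MvPolynomial (Fin n) Qbar ⧸
      Ideal.span (Set.range fun j : Fin n => pderiv j (map (Int.castRingHom Qbar) g))) ≤ ((s : ℕ∞) : WithBot ℕ∞) →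
    ∀ B : ℕ, 0 < B →
      ((Fintype.piFinset fun _ : Fin (k'+1) => gsBoxB n B).filter
        fun h => ∀ j, gsPsi (k'+1) g h j = 0).card ≤ c * B ^ (k' * n + s) := by
  obtain ⟨D, hD⟩ := gs_uniform (κ := Qbar) (σ := Fin n) (ι := Fin n ⊕ Fin s)
    (Sum.elim (fun _ => k' + 1) (fun _ => 1))
  refine ⟨(gsMonsLt (Fin (k'+1) × Fin n) D).card * (((k'+1)*n*2 + 1) ^ (k' * n + s)), ?_⟩
  intro g hg hdim B hB
  set G := map (Int.castRingHom Qbar) g with hG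
  have hGh : G.IsHomogeneous (k' + 2) := hg.map _
  have hJh : gsHom (Ideal.span (Set.range fun j : Fin n => pderiv j G)) := by
    apply gsHom_span
    rintro _ ⟨j, rfl⟩
    exact ⟨_, hGh.pderiv⟩
  obtain ⟨v, D', hD'⟩ := gs_sections s _ hJh hdim
  have hspan : Ideal.span (Set.range fun j : Fin n => pderiv j G) ⊔
      Ideal.span (Set.range fun l => gsLin (v l)) =
      Ideal.span (Set.range (Sum.elim (fun j : Fin n => pderiv j G) (fun l => gsLin (v l)))) := by
    rw [Set.Sum.elim_range, Ideal.span_union]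
  have hhom : ∀ x, (Sum.elim (fun j : Fin n => pderiv j G) (fun l => gsLin (v l)) x).IsHomogeneous
      ((Sum.elim (fun _ => k' + 1) (fun _ => 1) : Fin n ⊕ Fin s → ℕ) x) := by
    rintro (j | l)
    · have := hGh.pderiv (i := j)
      simpa using this
    · exact gsLin_hom (v l)
  have h1 := hD _ hhom ⟨D', by rw [← hspan]; exact hD'⟩
  rw [← hspan] at h1
  have h2 := gs_diag G hGh v h1
  have hIh : gsHom (Ideal.span (Set.range (gsPoly (k'+1) G))) := by
    apply gsHom_span
    rintro _ ⟨j, rfl⟩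
    exact ⟨_, gsPoly_hom _ _ _⟩
  let A : Finset Qbar := (Finset.Ioo (-(B:ℤ)) B).image (fun z : ℤ => (z : Qbar))
  let N := (Fintype.piFinset fun _ : Fin (k'+1) => gsBoxB n B).filter
        fun h => ∀ j, gsPsi (k'+1) g h j = 0
  let F : (Fin (k'+1) → Fin n → ℤ) → (Fin (k'+1) × Fin n → Qbar) := fun h p => ((h p.1 p.2 : ℤ) : Qbar)
  have hF : Function.Injective F := by
    intro h h' hh
    funext t i
    have := congrFun hh (t, i)
    simpa [F] using this
  have h3 := gs_polymethod _ hIh (gsCut (k' := k') v) (gsCut_hom v) D h2 A (N.image F) (by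
    intro x hx p
    obtain ⟨h, hh, rfl⟩ := Finset.mem_image.mp hx
    have := Fintype.mem_piFinset.mp (Finset.mem_filter.mp hh).1 p.1
    exact Finset.mem_image_of_mem _ (Fintype.mem_piFinset.mp this p.2)) (by
    intro x hx p hp
    obtain ⟨h, hh, rfl⟩ := Finset.mem_image.mp hx
    have hle : Ideal.span (Set.range (gsPoly (k'+1) G)) ≤ RingHom.ker (eval (F h)) := by
      refine Ideal.span_le.mpr ?_
      rintro _ ⟨j, rfl⟩
      change eval (F h) _ = 0
      rw [gsPoly_eval]
      have := gsPsi_map (Int.castRingHom Qbar) (k'+1) g h j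
      rw [(Finset.mem_filter.mp hh).2 j, map_zero] at this
      exact this
    exact hle hp)
  rw [Finset.card_image_of_injective _ hF] at h3
  refine h3.trans ?_
  rw [mul_assoc, ← mul_pow]
  simp only [Fintype.card_prod, Fintype.card_fin, Fintype.card_sum]
  have hA : A.card ≤ 2 * B := by
    refine Finset.card_image_le.trans ?_
    rw [Int.card_Ioo]; omega
  gcongr
  calc (k'+1)*n*A.card + 1 ≤ (k'+1)*n*(2*B) + B := by gcongr; omega
    _ = _ := by ring


lemma gs_Sgauss_eq {n R : ℕ} (f : Fin R → MvPolynomial (Fin n) ℤ) (q : ℕ) (a : Fin R → ℤ) :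
    Sgauss f q a = ∑ x : Fin n → Fin q,
      eC ((eval (fun j => ((x j : ℕ) : ℤ)) (∑ i, a i • f i) : ℝ) / q) := by
  unfold Sgauss
  refine Finset.sum_congr rfl fun x _ => ?_
  congr 2
  rw [map_sum]
  push_cast
  refine Finset.sum_congr rfl fun i _ => ?_
  rw [smul_eval]
  push_cast
  rfl

lemma gs_norm_eC (t : ℝ) : ‖eC t‖ = 1 := by
  unfold eC
  rw [show 2 * (Real.pi : ℂ) * Complex.I * (t : ℂ) = ((2 * Real.pi * t : ℝ) : ℂ) * Complex.I by
    push_cast; ring]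
  exact Complex.norm_exp_ofReal_mul_I _

lemma gs_trivial {n R : ℕ} (f : Fin R → MvPolynomial (Fin n) ℤ) (q : ℕ) (a : Fin R → ℤ) :
    ‖Sgauss f q a‖ ≤ (q : ℝ) ^ n := by
  unfold Sgauss
  refine (norm_sum_le _ _).trans ?_
  simp [gs_norm_eC]

lemma gs_singDim_le (n : ℕ) (g : MvPolynomial (Fin n) Qbar) : singDim n g ≤ ((n : ℕ∞) : WithBot ℕ∞) := by
  refine (ringKrullDim_quotient_le _).trans ?_
  rw [MvPolynomial.ringKrullDim_of_isNoetherianRing, ringKrullDim_eq_zero_of_field]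
  simp

open Classical in
/-- The count-based bound, with the parameter `B` still free. -/
lemma gs_core {n R k' s c₀ : ℕ} (hR : 0 < R) (hn : 0 < n) (f : Fin R → MvPolynomial (Fin n) ℤ)
    (hf : ∀ i, (f i).totalDegree = k' + 2) (T : ℕ) (hT : 0 < T)
    (hTc : ∀ i m, |coeff m (homogeneousComponent (k' + 2) (f i))| ≤ T)
    (hs : birchDelta n R (fun i => homogeneousComponent (k' + 2) (f i)) ≤ ((s : ℕ∞) : WithBot ℕ∞))
    (hc₀ : ∀ g : MvPolynomial (Fin n) ℤ, g.IsHomogeneous (k' + 2) →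
      ringKrullDim (MvPolynomial (Fin n) Qbar ⧸
        Ideal.span (Set.range fun j : Fin n => pderiv j (map (Int.castRingHom Qbar) g))) ≤ ((s : ℕ∞) : WithBot ℕ∞) →
      ∀ B : ℕ, 0 < B →
        ((Fintype.piFinset fun _ : Fin (k'+1) => gsBoxB n B).filter
          fun h => ∀ j, gsPsi (k'+1) g h j = 0).card ≤ c₀ * B ^ (k' * n + s))
    (q : ℕ) (hq : 0 < q) (a : Fin R → ℤ) (hgcd : Int.gcd (Finset.univ.gcd a) (q : ℤ) = 1)
    (B : ℕ) (hB : 0 < B)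
    (hlt : R.factorial * (n ^ (k'+1) * ((k' + 1 + 1) ^ (k' + 1 + 1) * T) * B ^ (k'+1)) ^ R < q) :
    ‖Sgauss f q a‖ ^ (2 ^ (k'+1)) * (B : ℝ) ^ n ≤
      (2 ^ (n * (k'+1)) * c₀) * ((q : ℝ) ^ n) ^ (2 ^ (k'+1)) * (B : ℝ) ^ s := by
  set g : Fin R → MvPolynomial (Fin n) ℤ := fun i => homogeneousComponent (k' + 2) (f i) with hg
  obtain ⟨b, hb0, hb⟩ := gs_relation (k := k'+1) a hgcd g (fun i m _ => hTc i m) hlt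
  have hBq : B ≤ q := by
    refine le_trans ?_ hlt.le
    have h1 : 1 ≤ R.factorial := Nat.factorial_pos R
    have h2 : 1 ≤ n ^ (k'+1) * ((k' + 1 + 1) ^ (k' + 1 + 1) * T) := Nat.pos_of_ne_zero (by positivity)
    calc B ≤ B ^ (k'+1) := Nat.le_self_pow (by omega) B
      _ ≤ (B ^ (k'+1)) ^ R := Nat.le_self_pow (by omega) _
      _ = 1 * (1 * B ^ (k'+1)) ^ R := by ring
      _ ≤ _ := by gcongr
  have hlt' : gsLt (k' + 1 + 2) (∑ i, a i • f i) := by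
    intro m hm
    rw [coeff_sum]
    refine Finset.sum_eq_zero fun i _ => ?_
    rw [coeff_smul, coeff_eq_zero_of_totalDegree_lt, smul_zero]
    rw [hf i]
    have : m.degree = ∑ i ∈ m.support, m i := rfl
    omega
  have hcB : q ≤ (q / B + 1) * B := by
    have := Nat.div_add_mod q B
    have h2 := Nat.mod_lt q hB
    nlinarith
  have hcB2 : (q / B + 1) * B ≤ 2 * q := by
    have := Nat.div_mul_le_self q B
    nlinarith
  have hw := gs_weyl_shrunk hq hB hcB _ hlt'
  rw [← gs_Sgauss_eq] at hw
  have hpsi : ∀ (h : Fin (k'+1) → Fin n → ℤ) (j : Fin n), gsPsi (k'+1) (∑ i, a i • f i) h j = gsPsi (k'+1) (∑ i, a i • g i) h j := by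
    intro h j
    apply gsPsi_congr
    intro m hm
    simp only [coeff_sum, coeff_smul]
    refine Finset.sum_congr rfl fun i _ => ?_
    rw [hg, coeff_homogeneousComponent, if_pos hm]
  simp only [hpsi] at hw
  have hhom : (∑ i, b i • g i).IsHomogeneous (k' + 2) := by
    refine IsHomogeneous.sum _ _ _ fun i _ => ?_
    have := (isHomogeneous_C (Fin n) (b i)).mul (homogeneousComponent_isHomogeneous (k'+2) (f i))
    rw [zero_add] at this
    rw [smul_eq_C_mul]
    exact this
  have hdim : singDim n (map (Int.castRingHom Qbar) (∑ i, b i • g i)) ≤ ((s : ℕ∞) : WithBot ℕ∞) := by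
    refine le_trans ?_ hs
    exact le_iSup₂ (f := fun (b : Fin R → ℤ) (_ : b ≠ 0) =>
      singDim n (MvPolynomial.map (Int.castRingHom Qbar) (∑ i, b i • g i))) b hb0
  have hN := (Finset.card_le_card hb).trans (hc₀ _ hhom hdim B hB)
  have hN' : ((((Fintype.piFinset fun _ : Fin (k'+1) => gsBoxB n B).filter
        fun h => ∀ j, (q : ℤ) ∣ gsPsi (k'+1) (∑ i, a i • g i) h j).card : ℕ) : ℝ) ≤
      (c₀ : ℝ) * (B : ℝ) ^ (k' * n + s) := by exact_mod_cast hN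
  have hq' : (0 : ℝ) < q := by exact_mod_cast hq
  have hB' : (0 : ℝ) < B := by exact_mod_cast hB
  have hcB3 : (((q / B + 1 : ℕ)) : ℝ) * B ≤ 2 * q := by exact_mod_cast hcB2
  set cc : ℝ := (((q / B + 1 : ℕ)) : ℝ) with hcc
  have hcc0 : 0 ≤ cc := by positivity
  set S := ‖Sgauss f q a‖ ^ (2 ^ (k'+1)) with hS
  have key : (S * (B : ℝ) ^ n) * (((q : ℝ) ^ n) ^ (k'+1) * ((B : ℝ) ^ (k' * n))) ≤
      ((2 ^ (n * (k'+1)) * c₀) * ((q : ℝ) ^ n) ^ (2 ^ (k'+1)) * (B : ℝ) ^ s) *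
        (((q : ℝ) ^ n) ^ (k'+1) * ((B : ℝ) ^ (k' * n))) := by
    calc (S * (B : ℝ) ^ n) * (((q : ℝ) ^ n) ^ (k'+1) * ((B : ℝ) ^ (k' * n)))
        = (S * ((q : ℝ) ^ n) ^ (k'+1)) * ((B : ℝ) ^ n) ^ (k'+1) := by ring
      _ ≤ (((q : ℝ) ^ n) ^ (2 ^ (k'+1)) * ((cc ^ n) ^ (k'+1) * ((c₀ : ℝ) * (B : ℝ) ^ (k' * n + s)))) *
            ((B : ℝ) ^ n) ^ (k'+1) := by
          refine mul_le_mul_of_nonneg_right (hw.trans ?_) (by positivity)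
          gcongr
      _ = ((q : ℝ) ^ n) ^ (2 ^ (k'+1)) * ((c₀ : ℝ) * (B : ℝ) ^ (k' * n + s)) *
            ((cc * B) ^ n) ^ (k'+1) := by rw [mul_pow cc, mul_pow (cc^n)]; ring
      _ ≤ ((q : ℝ) ^ n) ^ (2 ^ (k'+1)) * ((c₀ : ℝ) * (B : ℝ) ^ (k' * n + s)) *
            ((2 * q) ^ n) ^ (k'+1) := by gcongr
      _ = _ := by
          rw [mul_pow 2 (q:ℝ), mul_pow (2^n), ← pow_mul 2 n (k'+1), pow_add]; ring
  exact le_of_mul_le_mul_right key (by positivity)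

/-- The choice of the parameter `B`. -/
lemma gs_choose (R k' w q : ℕ) (hR : 0 < R) (hw : 0 < w)
    (h1 : R.factorial * (w * 1 ^ (k'+1)) ^ R < q) :
    ∃ B : ℕ, 0 < B ∧ R.factorial * (w * B ^ (k'+1)) ^ R < q ∧
      q ≤ R.factorial * (w * (2 * B) ^ (k'+1)) ^ R := by
  have hex : ∃ B : ℕ, q ≤ R.factorial * (w * B ^ (k'+1)) ^ R := by
    refine ⟨q, ?_⟩
    calc q ≤ q ^ (k'+1) := Nat.le_self_pow (by omega) q
      _ ≤ (q ^ (k'+1)) ^ R := Nat.le_self_pow (by omega) _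
      _ = 1 * (1 * q ^ (k'+1)) ^ R := by ring
      _ ≤ _ := by
        have := Nat.factorial_pos R
        gcongr <;> omega
  classical
  have h2 := Nat.find_spec hex
  have h3 : ∀ B < Nat.find hex, R.factorial * (w * B ^ (k'+1)) ^ R < q := fun B hB =>
    not_le.mp (Nat.find_min hex hB)
  have h4 : 1 < Nat.find hex := by
    by_contra hcon
    have : q ≤ R.factorial * (w * 1 ^ (k'+1)) ^ R := h2.trans (by gcongr; omega)
    omega
  refine ⟨Nat.find hex - 1, by omega, h3 _ (by omega), h2.trans ?_⟩
  gcongr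
  omega

/-- **Lemma 2.2 (bound for the complete exponential sums `S_{a,q}`).** -/
theorem gauss_sum_bound (n R d : ℕ) (hR : 0 < R) (hd : 2 ≤ d) (hnR : R < n)
    (ε : ℝ) (hε : 0 < ε) :
    ∃ c : ℝ, 0 < c ∧
      ∀ (f : Fin R → MvPolynomial (Fin n) ℤ),
        (∀ i, (f i).totalDegree = d) →
        ∀ Ct K : ℝ, 1 ≤ Ct →
        coeffMax (fun i => MvPolynomial.homogeneousComponent d (f i)) Ct →
        KofDelta n R d (fun i => MvPolynomial.homogeneousComponent d (f i)) K →
        ∀ q : ℕ, 0 < q → ∀ a : Fin R → ℤ, Int.gcd (Finset.univ.gcd a) (q : ℤ) = 1 →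
          ‖Sgauss f q a‖ ≤ c * Ct ^ (K / ((d : ℝ) - 1)) *
            (q : ℝ) ^ ((n : ℝ) - K / ((R : ℝ) * ((d : ℝ) - 1)) + ε) := by
  obtain ⟨k', rfl⟩ : ∃ k', d = k' + 2 := ⟨d - 2, by omega⟩
  have hn : 0 < n := by omega
  choose cs hcs using fun s : ℕ => gs_count n k' s
  set c₃ : ℝ := 1 + 2 ^ (n * (k'+1)) * ∑ s ∈ Finset.range (n+1), (cs s : ℝ) with hc₃
  have hc₃1 : 1 ≤ c₃ := by
    have : 0 ≤ 2 ^ (n * (k'+1)) * ∑ s ∈ Finset.range (n+1), (cs s : ℝ) := by positivity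
    linarith
  set w₀ : ℕ := n ^ (k'+1) * (k' + 1 + 1) ^ (k' + 1 + 1) with hw₀
  have hw₀p : 0 < w₀ := by positivity
  set c₂ : ℝ := (R.factorial : ℝ) * ((w₀ : ℝ) * 2 ^ (k'+1)) ^ R with hc₂
  have hfac : (1 : ℝ) ≤ R.factorial := by exact_mod_cast Nat.factorial_pos R
  have hw₀1 : (1 : ℝ) ≤ w₀ := by exact_mod_cast hw₀p
  have hc₂1 : 1 ≤ c₂ := by
    have h2 : (1 : ℝ) ≤ 2 ^ (k'+1) := one_le_pow₀ (by norm_num)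
    have h3 : (1 : ℝ) ≤ ((w₀ : ℝ) * 2 ^ (k'+1)) ^ R := one_le_pow₀ (by nlinarith)
    nlinarith
  refine ⟨c₃ * c₂ ^ (n : ℝ), by positivity, ?_⟩
  intro f hf Ct K hCt hcm hK q hq a hgcd
  obtain ⟨Δ, hΔ, rfl⟩ := hK
  have hΔn : Δ ≤ n := by
    have : ((Δ : ℕ∞) : WithBot ℕ∞) ≤ ((n : ℕ∞) : WithBot ℕ∞) := by
      rw [hΔ]
      exact iSup₂_le fun b _ => gs_singDim_le n _
    exact_mod_cast this
  obtain ⟨T, hTC⟩ : ∃ T : ℕ, Ct = T := by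
    obtain ⟨i, m, h⟩ := hcm.1
    refine ⟨(coeff m (homogeneousComponent (k'+2) (f i))).natAbs, ?_⟩
    rw [h, Nat.cast_natAbs, Int.cast_abs]
  have hT1 : 0 < T := by
    rw [hTC] at hCt
    exact_mod_cast (lt_of_lt_of_le one_pos hCt)
  have hTc : ∀ i m, |coeff m (homogeneousComponent (k' + 2) (f i))| ≤ T := by
    intro i m
    have := hcm.2 ⟨i, m, rfl⟩
    rw [hTC] at this
    exact_mod_cast this
  have hT1' : (1 : ℝ) ≤ T := by exact_mod_cast hT1
  have hq1 : (1 : ℝ) ≤ q := by exact_mod_cast hq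
  -- the main dichotomy
  have main : ∃ B : ℕ, 0 < B ∧ (q : ℝ) ≤ c₂ * (T : ℝ) ^ R * (B : ℝ) ^ ((k'+1) * R) ∧
      ‖Sgauss f q a‖ ^ (2 ^ (k'+1)) * (B : ℝ) ^ n ≤
        c₃ * ((q : ℝ) ^ n) ^ (2 ^ (k'+1)) * (B : ℝ) ^ Δ := by
    by_cases h1 : R.factorial * ((w₀ * T) * 1 ^ (k'+1)) ^ R < q
    · obtain ⟨B, hB, hB1, hB2⟩ := gs_choose R k' (w₀ * T) q hR (by positivity) h1
      refine ⟨B, hB, ?_, ?_⟩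
      · have : (q : ℝ) ≤ R.factorial * ((w₀ * T) * (2 * B) ^ (k'+1)) ^ R := by exact_mod_cast hB2
        refine this.trans (le_of_eq ?_)
        rw [hc₂, pow_mul]
        simp only [mul_pow]
        ring
      · have h := gs_core hR hn f hf T hT1 hTc hΔ.ge (hcs Δ) q hq a hgcd B hB (by
          have e : n ^ (k'+1) * ((k' + 1 + 1) ^ (k' + 1 + 1) * T) = w₀ * T := by rw [hw₀]; ring
          rw [e]; exact hB1)
        refine h.trans ?_
        have hle : 2 ^ (n * (k'+1)) * (cs Δ : ℝ) ≤ c₃ := by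
          have : (cs Δ : ℝ) ≤ ∑ s ∈ Finset.range (n+1), (cs s : ℝ) :=
            Finset.single_le_sum (f := fun s => (cs s : ℝ)) (fun _ _ => by positivity)
              (Finset.mem_range.mpr (by omega))
          have h5 : 2 ^ (n * (k'+1)) * (cs Δ : ℝ) ≤
            2 ^ (n * (k'+1)) * ∑ s ∈ Finset.range (n+1), (cs s : ℝ) := by gcongr
          linarith
        gcongr
    · refine ⟨1, one_pos, ?_, ?_⟩
      · have h2 : (q : ℝ) ≤ R.factorial * ((w₀ * T) * 1 ^ (k'+1)) ^ R := by exact_mod_cast not_lt.mp h1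
        refine h2.trans ?_
        rw [hc₂, Nat.cast_one, one_pow, one_pow, mul_one, mul_one, mul_assoc, ← mul_pow]
        have h3 : (1 : ℝ) ≤ 2 ^ (k'+1) := one_le_pow₀ (by norm_num)
        gcongr
        nlinarith
      · rw [Nat.cast_one, one_pow, one_pow, mul_one, mul_one]
        have h3 := gs_trivial f q a
        have h4 : ‖Sgauss f q a‖ ^ (2 ^ (k'+1)) ≤ ((q : ℝ) ^ n) ^ (2 ^ (k'+1)) := by gcongr
        refine h4.trans ?_
        exact le_mul_of_one_le_left (by positivity) hc₃1
  obtain ⟨B, hB, hqB, hS⟩ := main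
  have hB1 : (1 : ℝ) ≤ B := by exact_mod_cast hB
  have hB0 : (0 : ℝ) < B := by linarith
  have hq0 : (0 : ℝ) < q := by linarith
  have hT0 : (0 : ℝ) < T := by linarith
  rw [hTC]
  have ed : ((k' + 2 : ℕ) : ℝ) - 1 = (k' : ℝ) + 1 := by push_cast; ring
  rw [ed, show k' + 2 - 1 = k' + 1 from rfl]
  set K : ℝ := ((n : ℝ) - (Δ : ℝ)) / 2 ^ (k'+1) with hKdef
  have hΔn' : (Δ : ℝ) ≤ n := by exact_mod_cast hΔn
  have hp1 : (1 : ℝ) ≤ 2 ^ (k'+1) := one_le_pow₀ (by norm_num)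
  have hK0 : 0 ≤ K := div_nonneg (by linarith) (by positivity)
  have hKn : K ≤ n := by
    rw [hKdef, div_le_iff₀ (by positivity)]
    have : (0 : ℝ) ≤ Δ := by positivity
    nlinarith
  have hR1 : (1 : ℝ) ≤ R := by exact_mod_cast hR
  have hk1 : (1 : ℝ) ≤ (k' : ℝ) + 1 := by
    have : (0 : ℝ) ≤ k' := by positivity
    linarith
  -- extraction of the root
  have hSB : ‖Sgauss f q a‖ * (B : ℝ) ^ K ≤ c₃ * (q : ℝ) ^ n := by
    have hpow : (‖Sgauss f q a‖ * (B : ℝ) ^ K) ^ (2 ^ (k'+1)) ≤ (c₃ * (q : ℝ) ^ n) ^ (2 ^ (k'+1)) := by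
      have e1 : ((B : ℝ) ^ K) ^ (2 ^ (k'+1)) * (B : ℝ) ^ Δ = (B : ℝ) ^ n := by
        rw [← Real.rpow_natCast ((B : ℝ) ^ K), ← Real.rpow_mul hB0.le, ← Real.rpow_natCast (B : ℝ) Δ,
          ← Real.rpow_add hB0, ← Real.rpow_natCast (B : ℝ) n]
        congr 1
        rw [hKdef]
        push_cast
        field_simp
        ring
      have h6 : ‖Sgauss f q a‖ ^ (2 ^ (k'+1)) * ((B : ℝ) ^ K) ^ (2 ^ (k'+1)) * (B : ℝ) ^ Δ ≤
          c₃ * ((q : ℝ) ^ n) ^ (2 ^ (k'+1)) * (B : ℝ) ^ Δ := by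
        rw [mul_assoc, e1]; exact hS
      have h7 := le_of_mul_le_mul_right h6 (by positivity)
      rw [mul_pow, mul_pow]
      refine h7.trans ?_
      gcongr
      exact le_self_pow₀ hc₃1 (by positivity)
    exact le_of_pow_le_pow_left₀ (by positivity) (by positivity) hpow
  -- lower bound for B
  set u : ℝ := K / ((R : ℝ) * ((k' : ℝ) + 1)) with hu
  have hu0 : 0 ≤ u := by positivity
  have hun : u ≤ n := by
    rw [hu, div_le_iff₀ (by positivity)]
    have : (1 : ℝ) ≤ (R : ℝ) * ((k' : ℝ) + 1) := by nlinarith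
    have : (0 : ℝ) ≤ n := by positivity
    nlinarith
  have hqu : (q : ℝ) ^ u ≤ c₂ ^ (n : ℝ) * (T : ℝ) ^ (K / ((k' : ℝ) + 1)) * (B : ℝ) ^ K := by
    calc (q : ℝ) ^ u ≤ (c₂ * (T : ℝ) ^ R * (B : ℝ) ^ ((k'+1) * R)) ^ u :=
          Real.rpow_le_rpow hq0.le hqB hu0
      _ = c₂ ^ u * (T : ℝ) ^ (K / ((k' : ℝ) + 1)) * (B : ℝ) ^ K := by
          rw [Real.mul_rpow (by positivity) (by positivity), Real.mul_rpow (by positivity) (by positivity),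
            ← Real.rpow_natCast (T : ℝ), ← Real.rpow_natCast (B : ℝ), ← Real.rpow_mul hT0.le,
            ← Real.rpow_mul hB0.le]
          congr 2
          · congr 1
            rw [hu]; field_simp
          · rw [hu]; push_cast; field_simp
      _ ≤ _ := by
          gcongr
  have hfin : ‖Sgauss f q a‖ * (q : ℝ) ^ u ≤
      c₃ * c₂ ^ (n : ℝ) * (T : ℝ) ^ (K / ((k' : ℝ) + 1)) * (q : ℝ) ^ n := by
    calc ‖Sgauss f q a‖ * (q : ℝ) ^ u
        ≤ ‖Sgauss f q a‖ * (c₂ ^ (n : ℝ) * (T : ℝ) ^ (K / ((k' : ℝ) + 1)) * (B : ℝ) ^ K) := by gcongr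
      _ = c₂ ^ (n : ℝ) * (T : ℝ) ^ (K / ((k' : ℝ) + 1)) * (‖Sgauss f q a‖ * (B : ℝ) ^ K) := by ring
      _ ≤ c₂ ^ (n : ℝ) * (T : ℝ) ^ (K / ((k' : ℝ) + 1)) * (c₃ * (q : ℝ) ^ n) := by gcongr
      _ = _ := by ring
  rw [show (n : ℝ) - u + ε = ((n : ℝ) - u) + ε from rfl, Real.rpow_add hq0, Real.rpow_sub hq0,
    Real.rpow_natCast (q : ℝ)]
  have hqe : 1 ≤ (q : ℝ) ^ ε := Real.one_le_rpow hq1 hε.le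
  have hqu0 : 0 < (q : ℝ) ^ u := by positivity
  have h9 : ‖Sgauss f q a‖ ≤
      c₃ * c₂ ^ (n : ℝ) * (T : ℝ) ^ (K / ((k' : ℝ) + 1)) * ((q : ℝ) ^ n / (q : ℝ) ^ u) := by
    rw [← mul_div_assoc, le_div_iff₀ hqu0]
    exact hfin
  refine h9.trans ?_
  refine mul_le_mul_of_nonneg_left ?_ (by positivity)
  exact le_mul_of_one_le_right (by positivity) hqe

end
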